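/- arXiv:1504.04569 — 2 statements merged into one kernel-verified Lean document; each statement's English description precedes it below -/
import Mathlib

section
/- Let A be a unital C*-algebra and a, b ∈ A. Then the numerical range of the multiplication operator M_{a,b}(x) = axb, as an element of B(A), equals the closure of the union over all unitaries u of V(uau*b, A). -/
/-- Algebra numerical range of an element of a complex unital Banach algebra,
defined via states: `V(a) = {f a : f ∈ A*, ‖f‖ = 1 = f 1}`. -/
def numRange (A : Type*) [NormedRing A] [NormedAlgebra ℂ A] (a : A) : Set ℂ :=
  {z | ∃ f : A →L[ℂ] ℂ, ‖f‖ = 1 ∧ f 1 = 1 ∧ f a = z}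

set_option linter.all false
section Part1
set_option linter.unusedSectionVars false
open scoped InnerProductSpace

section dens
universe u
variable {A : Type u} [CStarAlgebra A] {ι : Type*} [Fintype ι] 
  {H : ι → Type u} [∀ i, NormedAddCommGroup (H i)] [∀ i, InnerProductSpace ℂ (H i)]
  [∀ i, CompleteSpace (H i)]

noncomputable def diagOp (T : ∀ i, H i →L[ℂ] H i) : PiLp 2 H →L[ℂ] PiLp 2 H :=
  ((PiLp.continuousLinearEquiv 2 ℂ H).symm : (∀ i, H i) →L[ℂ] PiLp 2 H) ∘L
    (ContinuousLinearMap.pi fun i => T i ∘L (PiLp.proj 2 H i : PiLp 2 H →L[ℂ] H i))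

lemma diagOp_apply (T : ∀ i, H i →L[ℂ] H i) (v : PiLp 2 H) (i : ι) :
    diagOp T v i = T i (v i) := rfl

lemma density (π : ∀ i, A →⋆ₐ[ℂ] (H i →L[ℂ] H i)) (T : ∀ i, H i →L[ℂ] H i)
    (hT : ∀ i j (S : H i →L[ℂ] H j), (∀ a v, S (π i a v) = π j a (S v)) →
      ∀ v, S (T i v) = T j (S v)) (x : ∀ i, H i) (ε : ℝ) (hε : 0 < ε) :
    ∃ a : A, ∀ i, ‖π i a (x i) - T i (x i)‖ < ε := by
  classical
  let Φ : A →ₗ[ℂ] PiLp 2 H :=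
    { toFun := fun a => WithLp.toLp 2 (fun i => π i a (x i))
      map_add' := fun a b => by ext i; simp
      map_smul' := fun c a => by ext i; simp }
  let K : Submodule ℂ (PiLp 2 H) := (LinearMap.range Φ).topologicalClosure
  have hKc : IsClosed (K : Set (PiLp 2 H)) := Submodule.isClosed_topologicalClosure _
  haveI : CompleteSpace K := hKc.completeSpace_coe
  let P := K.starProjection
  let Q : A → (PiLp 2 H →L[ℂ] PiLp 2 H) := fun a => diagOp (fun i => π i a)
  have hQK : ∀ a, ∀ v ∈ K, Q a v ∈ K := by
    intro a v hv
    have : Set.MapsTo (Q a) (LinearMap.range Φ : Set (PiLp 2 H)) (LinearMap.range Φ : Set (PiLp 2 H)) := by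
      rintro _ ⟨b, rfl⟩
      refine ⟨a * b, ?_⟩
      ext i
      simp [Φ, Q, diagOp_apply]
    have h2 := this.closure (Q a).continuous
    exact h2 hv
  have hQadj : ∀ a v w, ⟪Q a v, w⟫_ℂ = ⟪v, Q (star a) w⟫_ℂ := by
    intro a v w
    simp only [PiLp.inner_apply, Q, diagOp_apply, map_star]
    refine Finset.sum_congr rfl fun i _ => ?_
    rw [ContinuousLinearMap.star_eq_adjoint, ContinuousLinearMap.adjoint_inner_right]
  have hQK' : ∀ a, ∀ v ∈ Kᗮ, Q a v ∈ Kᗮ := by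
    intro a v hv
    rw [Submodule.mem_orthogonal'] at hv ⊢
    intro w hw
    rw [hQadj]
    exact hv _ (hQK _ _ hw)
  have hPQ : ∀ a v, P (Q a v) = Q a (P v) := by
    intro a v
    refine Submodule.eq_starProjection_of_mem_orthogonal (hQK _ _ (Submodule.starProjection_apply_mem K v)) ?_
    rw [← map_sub]
    exact hQK' _ _ (Submodule.sub_starProjection_mem_orthogonal v)
  have hsingle : ∀ v : PiLp 2 H, v = ∑ j, (PiLp.single 2 j (v j) : PiLp 2 H) := by
    intro v
    ext i
    simp [Finset.sum_apply, PiLp.single_apply, Pi.single_apply]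
  have hPT : ∀ v, P (diagOp T v) = diagOp T (P v) := by
    let J : ∀ j, H j →L[ℂ] PiLp 2 H := fun j =>
      ((PiLp.continuousLinearEquiv 2 ℂ H).symm : (∀ i, H i) →L[ℂ] PiLp 2 H) ∘L
        (ContinuousLinearMap.single ℂ H j)
    have hJ : ∀ j y, J j y = PiLp.single 2 j y := fun j y => rfl
    have hJD : ∀ (D : ∀ i, H i →L[ℂ] H i) j y, diagOp D (J j y) = J j (D j y) := by
      intro D j y
      ext i
      rw [diagOp_apply, hJ, hJ]
      by_cases h : i = j
      · subst h; simp
      · simp [h]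
    have key : ∀ j y, P (diagOp T (J j y)) = diagOp T (P (J j y)) := by
      intro j y
      ext i
      rw [diagOp_apply, hJD]
      refine hT j i ((PiLp.proj 2 H i : PiLp 2 H →L[ℂ] H i) ∘L P ∘L J j) ?_ y
      intro a v
      have h1 := hPQ a (J j v)
      simp only [Q, hJD] at h1
      have h2 := congrArg (fun w : PiLp 2 H => w i) h1
      simpa [diagOp_apply] using h2
    intro v
    rw [hsingle v]
    simp only [map_sum]
    exact Finset.sum_congr rfl fun j _ => key j (v j)
  have hxK : WithLp.toLp 2 x ∈ K := by
    apply Submodule.le_topologicalClosure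
    exact ⟨1, by ext i; simp [Φ]⟩
  have hTx : diagOp T (WithLp.toLp 2 x) ∈ K := by
    rw [← Submodule.starProjection_eq_self_iff (K := K)]
    rw [hPT, Submodule.starProjection_eq_self_iff.2 hxK]
  obtain ⟨y, ⟨a, rfl⟩, hy⟩ := Metric.mem_closure_iff.1 (show _ ∈ closure (LinearMap.range Φ : Set (PiLp 2 H)) from hTx) ε hε
  refine ⟨a, fun i => lt_of_le_of_lt ?_ hy⟩
  rw [dist_comm, dist_eq_norm]
  exact PiLp.norm_apply_le (Φ a - diagOp T (WithLp.toLp 2 x)) i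

lemma density_sa (π : ∀ i, A →⋆ₐ[ℂ] (H i →L[ℂ] H i)) (T : ∀ i, H i →L[ℂ] H i)
    (hsa : ∀ i v w, ⟪T i v, w⟫_ℂ = ⟪v, T i w⟫_ℂ)
    (hT : ∀ i j (S : H i →L[ℂ] H j), (∀ a v, S (π i a v) = π j a (S v)) →
      ∀ v, S (T i v) = T j (S v)) (x : ∀ i, H i) (ε : ℝ) (hε : 0 < ε) :
    ∃ a : A, IsSelfAdjoint a ∧ ∀ i, ‖π i a (x i) - T i (x i)‖ < ε := by
  classical
  letI : InnerProductSpace ℝ (PiLp 2 H) := InnerProductSpace.rclikeToReal ℂ _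
  let Φ : selfAdjoint A →ₗ[ℝ] PiLp 2 H :=
    { toFun := fun a => WithLp.toLp 2 (fun i => π i a (x i))
      map_add' := fun a b => by ext i; simp
      map_smul' := fun c a => by
        ext i
        have : ((c • a : selfAdjoint A) : A) = (c : ℂ) • (a : A) := by simp
        simp only [RingHom.id_apply, this, map_smul]
        change (c : ℂ) • (π i (a : A) (x i)) = c • (π i (a : A) (x i))
        simp }
  let K : Submodule ℝ (PiLp 2 H) := (LinearMap.range Φ).topologicalClosure
  have hKc : IsClosed (K : Set (PiLp 2 H)) := Submodule.isClosed_topologicalClosure _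
  haveI : CompleteSpace K := hKc.completeSpace_coe
  let X : PiLp 2 H := WithLp.toLp 2 x
  have hTx : diagOp T X ∈ K := by
    by_contra hcon
    let w := diagOp T X - K.starProjection (diagOp T X)
    have hw : w ∈ Kᗮ := Submodule.sub_starProjection_mem_orthogonal _
    have hw0 : ⟪diagOp T X, w⟫_ℝ ≠ 0 := by
      intro h0
      have h1 : ⟪w, w⟫_ℝ = 0 := by
        have h2 : ⟪K.starProjection (diagOp T X), w⟫_ℝ = 0 :=
          (Submodule.mem_orthogonal _ _).1 hw _ (Submodule.starProjection_apply_mem _ _)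
        have : ⟪w, w⟫_ℝ = ⟪diagOp T X, w⟫_ℝ - ⟪K.starProjection (diagOp T X), w⟫_ℝ := by
          rw [← inner_sub_left]
        rw [this, h0, h2, sub_zero]
      rw [inner_self_eq_zero] at h1
      apply hcon
      have : diagOp T X = K.starProjection (diagOp T X) := sub_eq_zero.1 h1
      rw [this]
      exact Submodule.starProjection_apply_mem _ _
    have hreal : ∀ v v' : PiLp 2 H, ⟪v, v'⟫_ℝ = (∑ i, ⟪v i, v' i⟫_ℂ).re := by
      intro v v'
      rw [← PiLp.inner_apply]; rfl
    set c := ⟪diagOp T X, w⟫_ℝ with hc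
    have horth : ∀ a : A, ∑ i, ((⟪π i a (x i), w i⟫_ℂ).re + (⟪x i, π i a (w i)⟫_ℂ).re) = 0 := by
      intro a
      have h1 : ⟪Φ ⟨a + star a, IsSelfAdjoint.add_star_self a⟩, w⟫_ℝ = 0 :=
        (Submodule.mem_orthogonal _ _).1 hw _
          (Submodule.le_topologicalClosure _ ⟨_, rfl⟩)
      rw [hreal, Complex.re_sum] at h1
      rw [← h1]
      refine Finset.sum_congr rfl fun i _ => ?_
      simp only [Φ, LinearMap.coe_mk, AddHom.coe_mk, map_add, ContinuousLinearMap.add_apply,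
        inner_add_left, Complex.add_re, map_star]
      rw [ContinuousLinearMap.star_eq_adjoint, ContinuousLinearMap.adjoint_inner_left]
    let B : ℝ := ∑ i, (‖w i‖ + ‖x i‖)
    have hB : 0 ≤ B := Finset.sum_nonneg fun i _ => by positivity
    have hδ : 0 < |c| / (B + 1) := by have := abs_pos.2 hw0; positivity
    obtain ⟨a, ha⟩ := density (ι := ι ⊕ ι) (H := fun s => H (Sum.elim id id s))
      (fun s => π (Sum.elim id id s)) (fun s => T (Sum.elim id id s))
      (fun s t S hS v => hT _ _ S hS v)
      (fun s => match s with
        | Sum.inl i => x i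
        | Sum.inr i => w i) _ hδ
    have ha1 : ∀ i, ‖π i a (x i) - T i (x i)‖ < _ := fun i => ha (Sum.inl i)
    have ha2 : ∀ i, ‖π i a (w i) - T i (w i)‖ < _ := fun i => ha (Sum.inr i)
    have hc2 : 2 * c = ∑ i, ((⟪T i (x i), w i⟫_ℂ).re + (⟪x i, T i (w i)⟫_ℂ).re) := by
      rw [hc, hreal, Complex.re_sum, Finset.mul_sum]
      refine Finset.sum_congr rfl fun i _ => ?_
      rw [diagOp_apply, ← hsa]; simp [X]; ring
    have h3 : 2 * c = ∑ i, ((⟪T i (x i) - π i a (x i), w i⟫_ℂ).re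
        + (⟪x i, T i (w i) - π i a (w i)⟫_ℂ).re) := by
      rw [← sub_zero (2 * c), hc2, ← horth a, ← Finset.sum_sub_distrib]
      refine Finset.sum_congr rfl fun i _ => ?_
      simp only [inner_sub_left, inner_sub_right, Complex.sub_re]; ring
    have h4 : |2 * c| ≤ ∑ i, (|c| / (B + 1)) * (‖w i‖ + ‖x i‖) := by
      rw [h3]
      refine (Finset.abs_sum_le_sum_abs _ _).trans (Finset.sum_le_sum fun i _ => ?_)
      refine (abs_add_le _ _).trans ?_
      rw [mul_add]
      refine add_le_add ?_ ?_
      · refine (Complex.abs_re_le_norm _).trans ((norm_inner_le_norm _ _).trans ?_)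
        rw [norm_sub_rev]
        exact mul_le_mul_of_nonneg_right (ha1 i).le (norm_nonneg _)
      · refine (Complex.abs_re_le_norm _).trans ((norm_inner_le_norm _ _).trans ?_)
        rw [norm_sub_rev, mul_comm]
        exact mul_le_mul_of_nonneg_right (ha2 i).le (norm_nonneg _)
    rw [← Finset.mul_sum] at h4
    have h5 : |c| / (B + 1) * B ≤ |c| := by
      rw [div_mul_eq_mul_div, div_le_iff₀ (by positivity)]
      nlinarith [abs_nonneg c]
    have h6 : |2 * c| = 2 * |c| := by rw [abs_mul]; simp
    have := abs_pos.2 hw0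
    change |2 * c| ≤ |c| / (B + 1) * B at h4
    linarith
  obtain ⟨y, ⟨a, rfl⟩, hy⟩ := Metric.mem_closure_iff.1 (show _ ∈ closure (LinearMap.range Φ : Set (PiLp 2 H)) from hTx) ε hε
  refine ⟨a, a.2, fun i => lt_of_le_of_lt ?_ hy⟩
  rw [dist_comm, dist_eq_norm]
  exact PiLp.norm_apply_le (Φ a - diagOp T X) i

lemma pi_norm_le {H : Type*} [NormedAddCommGroup H] [InnerProductSpace ℂ H] [CompleteSpace H]
    (π : A →⋆ₐ[ℂ] (H →L[ℂ] H)) (a : A) (v : H) : ‖π a v‖ ≤ ‖a‖ * ‖v‖ :=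
  ((π a).le_opNorm v).trans (mul_le_mul_of_nonneg_right (NonUnitalStarAlgHom.norm_apply_le π a) (norm_nonneg _))

lemma pi_inner {H : Type*} [NormedAddCommGroup H] [InnerProductSpace ℂ H] [CompleteSpace H]
    (π : A →⋆ₐ[ℂ] (H →L[ℂ] H)) (a : A) (v w : H) : ⟪π a v, w⟫_ℂ = ⟪v, π (star a) w⟫_ℂ := by
  rw [map_star, ContinuousLinearMap.star_eq_adjoint, ContinuousLinearMap.adjoint_inner_right]

lemma pi_unitary_inner {H : Type*} [NormedAddCommGroup H] [InnerProductSpace ℂ H] [CompleteSpace H]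
    (π : A →⋆ₐ[ℂ] (H →L[ℂ] H)) {u : A} (hu : u ∈ unitary A) (v w : H) :
    ⟪π u v, π u w⟫_ℂ = ⟪v, w⟫_ℂ := by
  rw [pi_inner, ← ContinuousLinearMap.mul_apply, ← map_mul, (Unitary.mem_iff.1 hu).1, map_one]
  rfl

lemma pi_unitary_norm {H : Type*} [NormedAddCommGroup H] [InnerProductSpace ℂ H] [CompleteSpace H]
    (π : A →⋆ₐ[ℂ] (H →L[ℂ] H)) {u : A} (hu : u ∈ unitary A) (v : H) : ‖π u v‖ = ‖v‖ := by
  have := pi_unitary_inner π hu v v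
  rw [inner_self_eq_norm_sq_to_K, inner_self_eq_norm_sq_to_K] at this
  have h2 : ‖π u v‖ ^ 2 = ‖v‖ ^ 2 := by exact_mod_cast this
  exact (sq_eq_sq₀ (norm_nonneg _) (norm_nonneg _)).1 h2

/-- Cayley transform -/
lemma density_cayley (π : ∀ i, A →⋆ₐ[ℂ] (H i →L[ℂ] H i)) (T : ∀ i, H i →L[ℂ] H i)
    (hsa : ∀ i v w, ⟪T i v, w⟫_ℂ = ⟪v, T i w⟫_ℂ)
    (hT : ∀ i j (S : H i →L[ℂ] H j), (∀ a v, S (π i a v) = π j a (S v)) →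
      ∀ v, S (T i v) = T j (S v)) (x : ∀ i, H i) (ε : ℝ) (hε : 0 < ε) :
    ∃ u ∈ unitary A, ∀ i,
      ‖π i u (T i (x i) + Complex.I • x i) - (T i (x i) - Complex.I • x i)‖ < ε := by
  obtain ⟨h, hh, hx⟩ := density_sa π T hsa hT x (ε / 2) (by positivity)
  have hne : ∀ t : ℝ, (t : ℂ) + Complex.I ≠ 0 := by
    intro t h0
    have := congrArg Complex.im h0
    simp at this
  have hspec : ∀ z ∈ spectrum ℂ h, z + Complex.I ≠ 0 := by
    intro z hz
    have := hh.mem_spectrum_eq_re hz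
    rw [this]; exact hne _
  have hcont : ContinuousOn (fun z : ℂ => (z - Complex.I) / (z + Complex.I)) (spectrum ℂ h) := by
    refine ContinuousOn.div (by fun_prop) (by fun_prop) hspec
  let u := cfc (fun z : ℂ => (z - Complex.I) / (z + Complex.I)) h
  have hu : u ∈ unitary A := by
    rw [cfc_unitary_iff _ _ hh.isStarNormal hcont]
    intro z hz
    have hz2 := hh.mem_spectrum_eq_re hz
    have hz1 := hspec z hz
    rw [hz2]
    have h1 := hne z.re
    have h2 : (z.re : ℂ) - Complex.I ≠ 0 := by
      intro h0
      have := congrArg Complex.im h0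
      simp at this
    simp
    field_simp
    rw [← sub_eq_add_neg, div_self h2]
  have hmul : u * (h + Complex.I • 1) = h - Complex.I • 1 := by
    have h1 : h + Complex.I • (1 : A) = cfc (fun z : ℂ => z + Complex.I) h := by
      rw [cfc_add_const .., cfc_id' ℂ h hh.isStarNormal, Algebra.algebraMap_eq_smul_one]
    have h2 : h - Complex.I • (1 : A) = cfc (fun z : ℂ => z - Complex.I) h := by
      rw [cfc_sub .., cfc_id' ℂ h hh.isStarNormal, cfc_const .., Algebra.algebraMap_eq_smul_one]
    rw [h1, h2, ← cfc_mul _ _ h hcont (by fun_prop)]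
    refine cfc_congr fun z hz => ?_
    exact div_mul_cancel₀ _ (hspec z hz)
  refine ⟨u, hu, fun i => ?_⟩
  have e1 : π i u (π i h (x i) + Complex.I • x i) = π i h (x i) - Complex.I • x i := by
    have := congrArg (fun b => π i b (x i)) hmul
    simpa using this
  have e2 : π i u (T i (x i) + Complex.I • x i) - (T i (x i) - Complex.I • x i)
      = π i u (T i (x i) - π i h (x i)) + (π i h (x i) - T i (x i)) := by
    have : T i (x i) + Complex.I • x i = (T i (x i) - π i h (x i)) + (π i h (x i) + Complex.I • x i) := by
      abel
    rw [this, map_add, e1]; abel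
  rw [e2]
  refine (norm_add_le _ _).trans_lt ?_
  have h3 : ‖π i u (T i (x i) - π i h (x i))‖ ≤ ‖T i (x i) - π i h (x i)‖ :=
    (pi_unitary_norm _ hu _).le
  rw [norm_sub_rev] at h3
  linarith [hx i]

end dens

end Part1

section Part2
open scoped InnerProductSpace

universe u
structure Irr (A : Type u) [CStarAlgebra A] where
  H : Type u
  [ng : NormedAddCommGroup H]
  [ip : InnerProductSpace ℂ H]
  [cs : CompleteSpace H]
  π : A →⋆ₐ[ℂ] (H →L[ℂ] H)
  irr : ∀ T : H →L[ℂ] H, (∀ a v, T (π a v) = π a (T v)) → ∃ c : ℂ, ∀ v, T v = c • v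

attribute [instance] Irr.ng Irr.ip Irr.cs

noncomputable def refl' {H : Type*} [NormedAddCommGroup H] [InnerProductSpace ℂ H] (v : H) (ω : ℂ) (z : H) : H :=
  z + ((ω - 1) * ⟪v, z⟫_ℂ) • v

def Appr {A : Type u} [CStarAlgebra A] {κ : Type*} (ρ : κ → Irr A)
    (W : ∀ k, (ρ k).H → (ρ k).H) : Prop :=
  ∀ (n : ℕ) (j : Fin n → κ) (y : ∀ i, (ρ (j i)).H) (ε : ℝ), 0 < ε →
    ∃ u ∈ unitary A, ∀ i, ‖(ρ (j i)).π u (y i) - W (j i) (y i)‖ < ε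

section
variable {A : Type u} [CStarAlgebra A] {κ : Type*} {ρ : κ → Irr A}

lemma Appr.comp {W W' : ∀ k, (ρ k).H → (ρ k).H} (h : Appr ρ W) (h' : Appr ρ W') :
    Appr ρ (fun k x => W k (W' k x)) := by
  intro n j y ε hε
  obtain ⟨u, hu, h1⟩ := h' n j y (ε / 2) (by positivity)
  obtain ⟨w, hw, h2⟩ := h n j (fun i => W' (j i) (y i)) (ε / 2) (by positivity)
  refine ⟨w * u, mul_mem hw hu, fun i => ?_⟩
  have : (ρ (j i)).π (w * u) (y i) - W (j i) (W' (j i) (y i)) =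
      (ρ (j i)).π w ((ρ (j i)).π u (y i) - W' (j i) (y i)) +
      ((ρ (j i)).π w (W' (j i) (y i)) - W (j i) (W' (j i) (y i))) := by
    rw [map_sub, map_mul]; simp
  rw [this]
  refine (norm_add_le _ _).trans_lt ?_
  rw [pi_unitary_norm _ hw]
  linarith [h1 i, h2 i]

lemma appr_refl1 (hdisj : ∀ k l, k ≠ l → ∀ S : (ρ k).H →L[ℂ] (ρ l).H,
      (∀ a v, S ((ρ k).π a v) = (ρ l).π a (S v)) → S = 0)
    (v : ∀ k, (ρ k).H) (hv : ∀ k, ‖v k‖ = 1 ∨ v k = 0) (ω : κ → ℂ) (hω : ∀ k, ‖ω k‖ = 1)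
    (hω' : ∀ k, ω k ≠ -1) : Appr ρ (fun k => refl' (v k) (ω k)) := by
  intro n j y ε hε
  have hlam : ∀ k, ∃ l : ℝ, (l : ℂ) - Complex.I = -ω k * (l + Complex.I) := by
    intro k
    have h1 : 1 + ω k ≠ 0 := fun h => hω' k (by linear_combination h)
    have h2 : star (ω k) * ω k = 1 := by
      have := Complex.conj_mul' (ω k)
      rw [hω k] at this
      simpa using this
    have h0 : ω k ≠ 0 := by intro h; simpa [h] using hω k
    have h3 : (starRingEnd ℂ) (Complex.I * (1 - ω k) / (1 + ω k)) = Complex.I * (1 - ω k) / (1 + ω k) := by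
      have h5 : (starRingEnd ℂ) (ω k) = (ω k)⁻¹ := by
        exact eq_inv_of_mul_eq_one_left h2
      have h6 : ω k + 1 ≠ 0 := by rwa [add_comm]
      simp only [map_div₀, map_mul, Complex.conj_I, map_sub, map_one, map_add, h5]
      field_simp
      ring
    obtain ⟨l, hl⟩ := Complex.conj_eq_iff_real.1 h3
    refine ⟨l, ?_⟩
    rw [← hl]
    field_simp
    ring
  choose l hl using hlam
  have hne : ∀ t : ℝ, (t : ℂ) + Complex.I ≠ 0 := by
    intro t h0
    have := congrArg Complex.im h0
    simp at this
  let T : ∀ k, (ρ k).H →L[ℂ] (ρ k).H := fun k =>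
    (l k : ℂ) • (innerSL ℂ (v k)).smulRight (v k)
  have hTa : ∀ k z, T k z = (l k : ℂ) • (⟪v k, z⟫_ℂ • v k) := fun k z => rfl
  let x : ∀ i, (ρ (j i)).H := fun i =>
    (-Complex.I) • y i + (((l (j i) + Complex.I : ℂ)⁻¹ + Complex.I) * ⟪v (j i), y i⟫_ℂ) • v (j i)
  have hT : ∀ k m (S : (ρ k).H →L[ℂ] (ρ m).H), (∀ a v, S ((ρ k).π a v) = (ρ m).π a (S v)) →
      ∀ v, S (T k v) = T m (S v) := by
    intro k m S hS
    by_cases hkm : k = m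
    · subst hkm
      obtain ⟨c, hc⟩ := (ρ k).irr S hS
      intro v
      rw [hc, hc, map_smul]
    · rw [hdisj k m hkm S hS]; simp
  obtain ⟨u, hu, h⟩ := density_cayley (fun i => (ρ (j i)).π) (fun i => T (j i))
    (fun i z w => by
      rw [hTa, hTa, inner_smul_left, inner_smul_left, inner_smul_right, inner_smul_right]
      simp only [Complex.conj_ofReal, inner_conj_symm]; ring)
    (fun i i' S hS => hT _ _ S hS) x ε hε
  refine ⟨-u, by simpa [Unitary.mem_iff] using hu, fun i => ?_⟩
  have e1 : T (j i) (x i) + Complex.I • x i = y i := by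
    rcases hv (j i) with hv1 | hv0
    · have : ⟪v (j i), v (j i)⟫_ℂ = 1 := by simp [inner_self_eq_norm_sq_to_K, hv1]
      rw [hTa]
      simp only [x, inner_add_right, inner_smul_right, this, smul_add, smul_smul]
      have hI := Complex.I_mul_I
      have := hne (l (j i))
      have e : (Complex.I * -Complex.I) • y i = y i := by simp
      rw [e]
      rw [show ∀ (a b : ℂ) (p q : (ρ (j i)).H), a • q + (p + b • q) = p + (a + b) • q by
        intros; module]
      convert add_zero _ using 2
      rw [show ∀ (c : ℂ) (q : (ρ (j i)).H), c • q = 0 ↔ (c = 0 ∨ q = 0) from fun c q => smul_eq_zero]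
      left
      field_simp
      linear_combination (⟪v (j i), y i⟫_ℂ * (Complex.I + (l (j i)))) * hI
    · rw [hTa]; simp [x, hv0, smul_smul]
  have e2 : T (j i) (x i) - Complex.I • x i = -(refl' (v (j i)) (ω (j i)) (y i)) := by
    have : T (j i) (x i) - Complex.I • x i = (T (j i) (x i) + Complex.I • x i) - (2 * Complex.I) • x i := by
      module
    rw [this, e1]
    simp only [x, refl']
    have h5 : (2 * Complex.I) * ((l (j i) + Complex.I : ℂ)⁻¹ + Complex.I) = ω (j i) - 1 := by
      have := hne (l (j i))
      field_simp
      linear_combination (2 * (l (j i)) + 2 * Complex.I) * Complex.I_mul_I - hl (j i)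
    rw [smul_add, smul_smul, smul_smul, ← mul_assoc, h5]
    have : (2 * Complex.I * -Complex.I) = 2 := by linear_combination (-2) * Complex.I_mul_I
    rw [this]
    module
  have := h i
  simp only [e1, e2] at this
  rw [sub_neg_eq_add] at this
  rw [map_neg]
  simp only [ContinuousLinearMap.neg_apply]
  rw [← neg_add', norm_neg]
  exact this

lemma refl'_comp {H : Type*} [NormedAddCommGroup H] [InnerProductSpace ℂ H] (v : H)
    (hv : ‖v‖ = 1 ∨ v = 0) (ω : ℂ) (z : H) : refl' v ω (refl' v ω z) = refl' v (ω * ω) z := by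
  rcases hv with hv | rfl
  · have : ⟪v, v⟫_ℂ = 1 := by simp [inner_self_eq_norm_sq_to_K, hv]
    simp only [refl', inner_add_right, inner_smul_right, this]
    module
  · simp [refl']

lemma appr_refl (hdisj : ∀ k l, k ≠ l → ∀ S : (ρ k).H →L[ℂ] (ρ l).H,
      (∀ a v, S ((ρ k).π a v) = (ρ l).π a (S v)) → S = 0)
    (v : ∀ k, (ρ k).H) (hv : ∀ k, ‖v k‖ = 1 ∨ v k = 0) (ω : κ → ℂ) (hω : ∀ k, ‖ω k‖ = 1) :
    Appr ρ (fun k => refl' (v k) (ω k)) := by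
  have : ∀ k, ∃ w : ℂ, w * w = ω k ∧ ‖w‖ = 1 ∧ w ≠ -1 := by
    intro k
    obtain ⟨w, hw⟩ := IsAlgClosed.exists_eq_mul_self (ω k)
    have hn : ‖w‖ = 1 := by
      have h1 := hω k
      rw [hw, norm_mul] at h1
      nlinarith [norm_nonneg w]
    by_cases h : w = -1
    · exact ⟨1, by rw [hw, h]; simp, by simp, by norm_num⟩
    · exact ⟨w, hw.symm, hn, h⟩
  choose w h1 h2 h3 using this
  have h4 := appr_refl1 hdisj v hv w h2 h3
  have h5 := h4.comp h4
  simp only [fun k z => refl'_comp (v k) (hv k) (w k) z, h1] at h5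
  exact h5

lemma exists_refl {H : Type*} [NormedAddCommGroup H] [InnerProductSpace ℂ H] (y y' : H)
    (h : ‖y‖ = ‖y'‖) : ∃ (v : H) (ω : ℂ), (‖v‖ = 1 ∨ v = 0) ∧ ‖ω‖ = 1 ∧ refl' v ω y = y' ∧
      ∀ z, ⟪y - y', z⟫_ℂ = 0 → refl' v ω z = z := by
  by_cases hyy : y = y'
  · exact ⟨0, 1, Or.inr rfl, by simp, by simp [refl', hyy], by simp [refl']⟩
  have hd : y - y' ≠ 0 := sub_ne_zero.2 hyy
  have hn : 0 < ‖y - y'‖ := norm_pos_iff.2 hd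
  set d := y - y' with hdd
  set s := ⟪d, y⟫_ℂ with hs
  have hre : ((‖d‖ : ℂ)) ^ 2 = s + starRingEnd ℂ s := by
    have e1 : ((‖d‖ : ℂ)) ^ 2 = ⟪d, d⟫_ℂ := (inner_self_eq_norm_sq_to_K d).symm
    have e2 : ⟪y, y⟫_ℂ = ⟪y', y'⟫_ℂ := by
      rw [inner_self_eq_norm_sq_to_K, inner_self_eq_norm_sq_to_K, h]
    rw [e1, hs, inner_conj_symm, hdd]
    simp only [inner_sub_left, inner_sub_right]
    linear_combination -e2
  have hs0 : s ≠ 0 := by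
    intro h0
    rw [h0] at hre
    simp at hre
    exact hd hre
  have hds : (‖d‖ : ℂ) ≠ 0 := by exact_mod_cast hn.ne'
  refine ⟨(‖d‖ : ℂ)⁻¹ • d, -(starRingEnd ℂ s) / s, Or.inl ?_, ?_, ?_, ?_⟩
  · rw [norm_smul]; simp [hn.ne']
  · rw [norm_div, norm_neg, RCLike.norm_conj, div_self (norm_ne_zero_iff.2 hs0)]
  · rw [refl', inner_smul_left, ← hs, smul_smul]
    have : (-(starRingEnd ℂ) s / s - 1) * ((starRingEnd ℂ) (↑‖d‖)⁻¹ * s) * (↑‖d‖)⁻¹ = -1 := by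
      simp only [map_inv₀, Complex.conj_ofReal]
      field_simp
      linear_combination hre
    rw [this, hdd]; module
  · intro z hz
    rw [refl', inner_smul_left, hz]; simp

/-- transitivity -/
lemma transitivity (hdisj : ∀ k l, k ≠ l → ∀ S : (ρ k).H →L[ℂ] (ρ l).H,
      (∀ a v, S ((ρ k).π a v) = (ρ l).π a (S v)) → S = 0) [Finite κ]
    (x y ξ η : ∀ k, (ρ k).H) (h1 : ∀ k, ‖x k‖ = ‖ξ k‖) (h2 : ∀ k, ‖y k‖ = ‖η k‖)
    (h3 : ∀ k, ⟪x k, y k⟫_ℂ = ⟪ξ k, η k⟫_ℂ) (ε : ℝ) (hε : 0 < ε) :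
    ∃ u ∈ unitary A, ∀ k, ‖(ρ k).π u (x k) - ξ k‖ < ε ∧ ‖(ρ k).π u (y k) - η k‖ < ε := by
  have hin : ∀ {H : Type u} [NormedAddCommGroup H] [InnerProductSpace ℂ H] (v : H) (ω : ℂ)
    (hv : ‖v‖ = 1 ∨ v = 0) (hω : ‖ω‖ = 1) (z z' : H), ⟪refl' v ω z, refl' v ω z'⟫_ℂ = ⟪z, z'⟫_ℂ := by
    intro H _ _ v ω hv hω z z'
    rcases hv with hv | rfl
    · have : ⟪v, v⟫_ℂ = 1 := by simp [inner_self_eq_norm_sq_to_K, hv]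
      have h2 : starRingEnd ℂ (ω) * ω = 1 := by
        have := Complex.conj_mul' ω
        rw [hω] at this
        simpa using this
      simp only [refl', inner_add_right, inner_add_left, inner_smul_right, inner_smul_left, this, map_mul, map_sub, map_one, inner_conj_symm]
      linear_combination ⟪v, z'⟫_ℂ * ⟪z, v⟫_ℂ * h2
    · simp [refl']
  have hex1 := fun k => exists_refl (x k) (ξ k) (h1 k)
  choose v ω hv hω ha hb using hex1
  have hex2 := fun k => exists_refl (refl' (v k) (ω k) (y k)) (η k) (by
    rw [← h2 k, @norm_eq_sqrt_re_inner ℂ, hin _ _ (hv k) (hω k), ← norm_eq_sqrt_re_inner])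
  choose v' ω' hv' hω' ha' hb' using hex2
  have hA := (appr_refl hdisj v' hv' ω' hω').comp (appr_refl hdisj v hv ω hω)
  have hX : ∀ k, refl' (v' k) (ω' k) (refl' (v k) (ω k) (x k)) = ξ k := by
    intro k
    rw [ha k]
    apply hb'
    rw [inner_sub_left, sub_eq_zero, ← inner_conj_symm, ← inner_conj_symm (η k)]
    congr 1
    rw [← h3 k, ← ha k, hin _ _ (hv k) (hω k)]
  obtain ⟨n, ⟨e⟩⟩ := Finite.exists_equiv_fin (κ ⊕ κ)
  let g : ∀ s : κ ⊕ κ, (ρ (Sum.elim id id s)).H := fun s => match s with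
      | Sum.inl k => x k
      | Sum.inr k => y k
  obtain ⟨u, hu, h⟩ := hA n (fun i => Sum.elim id id (e.symm i)) (fun i => g (e.symm i)) ε hε
  have h' : ∀ s, ‖(ρ (Sum.elim id id s)).π u (g s) - refl' (v' (Sum.elim id id s)) (ω' (Sum.elim id id s))
      (refl' (v (Sum.elim id id s)) (ω (Sum.elim id id s)) (g s))‖ < ε := by
    intro s
    obtain ⟨i, rfl⟩ := e.symm.surjective s
    exact h i
  refine ⟨u, hu, fun k => ⟨?_, ?_⟩⟩
  · rw [← hX k]
    exact h' (Sum.inl k)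
  · rw [← ha' k]
    exact h' (Sum.inr k)
end

end Part2

section Part3
open scoped InnerProductSpace

section convexity
variable {H : Type*} [NormedAddCommGroup H] [InnerProductSpace ℂ H]

theorem rank2 (A1 A2 : ℝ) (w : ℂ) (h1 : 0 ≤ A1) (h2 : 0 ≤ A2) (h : A1 * A2 = ‖w‖^2) :
    ∃ c1 c2 : ℂ, ‖c1‖^2 = A1 ∧ ‖c2‖^2 = A2 ∧ (starRingEnd ℂ) c1 * c2 = w := by
  rcases h1.eq_or_lt with h0 | h0
  · refine ⟨0, (Real.sqrt A2 : ℂ), by simp [← h0], ?_, ?_⟩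
    · rw [Complex.norm_real, Real.norm_eq_abs, sq_abs, Real.sq_sqrt h2]
    · have : ‖w‖^2 = 0 := by rw [← h, ← h0]; simp
      have : w = 0 := by simpa using this
      simp [this]
  · have hs : 0 < Real.sqrt A1 := Real.sqrt_pos.2 h0
    have hs2 : (Real.sqrt A1)^2 = A1 := Real.sq_sqrt h1
    refine ⟨(Real.sqrt A1 : ℂ), w / (Real.sqrt A1 : ℂ), ?_, ?_, ?_⟩
    · rw [Complex.norm_real, Real.norm_eq_abs, sq_abs, hs2]
    · rw [norm_div, Complex.norm_real, Real.norm_eq_abs, div_pow, sq_abs, hs2, ← h]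
      field_simp
    · rw [Complex.conj_ofReal]
      have : (Real.sqrt A1 : ℂ) ≠ 0 := by exact_mod_cast hs.ne'
      field_simp

theorem form_expand (B C : H →L[ℂ] H) (x1 x2 : H) (c1 c2 : ℂ) :
    ⟪B (c1 • x1 + c2 • x2), C (c1 • x1 + c2 • x2)⟫_ℂ =
      ((‖c1‖^2 : ℝ) : ℂ) * ⟪B x1, C x1⟫_ℂ + ((‖c2‖^2 : ℝ) : ℂ) * ⟪B x2, C x2⟫_ℂ
      + ((starRingEnd ℂ) c1 * c2) * ⟪B x1, C x2⟫_ℂ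
      + (starRingEnd ℂ) ((starRingEnd ℂ) c1 * c2) * ⟪B x2, C x1⟫_ℂ := by
  have e : ∀ c : ℂ, ((‖c‖^2 : ℝ) : ℂ) = (starRingEnd ℂ) c * c := fun c => by
    rw [Complex.conj_mul']; push_cast; rfl
  rw [e, e]
  simp only [map_add, map_smul, inner_add_left, inner_add_right, inner_smul_left,
    inner_smul_right, map_mul, Complex.conj_conj]
  ring

theorem hker (s q1 q2 g1 g2 : ℂ) : ∃ (α γ : ℝ) (w : ℂ), (α ≠ 0 ∨ γ ≠ 0 ∨ w ≠ 0) ∧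
    α + γ + 2 * (w * s).re = 0 ∧
    (α : ℂ) * q1 + γ * q2 + w * g1 + (starRingEnd ℂ) w * g2 = 0 := by
  let L : (ℝ × ℝ × ℂ) →ₗ[ℝ] (ℝ × ℂ) :=
    { toFun := fun p => (p.1 + p.2.1 + 2 * (p.2.2 * s).re,
        (p.1 : ℂ) * q1 + p.2.1 * q2 + p.2.2 * g1 + (starRingEnd ℂ) p.2.2 * g2)
      map_add' := by
        intro p q
        ext1
        · simp [add_mul]; ring
        · simp [add_mul]; ring
      map_smul' := by
        intro c p
        ext1
        · simp; ring
        · simp; ring }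
  have : LinearMap.ker L ≠ ⊥ := by
    apply LinearMap.ker_ne_bot_of_finrank_lt
    simp [Module.finrank_prod, Complex.finrank_real_complex]
  obtain ⟨p, hp, hne⟩ := Submodule.exists_mem_ne_zero_of_ne_bot this
  have hp' : L p = 0 := hp
  refine ⟨p.1, p.2.1, p.2.2, ?_, congrArg Prod.fst hp', congrArg Prod.snd hp'⟩
  by_contra hcon
  push Not at hcon
  exact hne (Prod.ext hcon.1 (Prod.ext hcon.2.1 hcon.2.2))

theorem DWup (B : H →L[ℂ] H) (x1 x2 : H) (h1 : ‖x1‖ = 1) (h2 : ‖x2‖ = 1) (t : ℝ)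
    (ht0 : 0 ≤ t) (ht1 : t ≤ 1) : ∃ x : H, ‖x‖ = 1 ∧
      ⟪x, B x⟫_ℂ = ((1 - t : ℝ) : ℂ) * ⟪x1, B x1⟫_ℂ + (t : ℂ) * ⟪x2, B x2⟫_ℂ ∧
      (1 - t) * ‖B x1‖^2 + t * ‖B x2‖^2 ≤ ‖B x‖^2 := by
  by_cases hdep : ‖⟪x1, x2⟫_ℂ‖ = 1
  · have h0 : x1 ≠ 0 := by intro h; simp [h] at h1
    have h0' : x2 ≠ 0 := by intro h; simp [h] at h2
    have := (norm_inner_eq_norm_iff (𝕜 := ℂ) h0 h0').1 (by rw [hdep, h1, h2]; norm_num)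
    obtain ⟨r, hr, rfl⟩ := this
    have hr1 : ‖r‖ = 1 := by rwa [norm_smul, h1, mul_one] at h2
    have e : (starRingEnd ℂ) r * r = 1 := by rw [Complex.conj_mul', hr1]; simp
    refine ⟨x1, h1, ?_, ?_⟩
    · rw [map_smul, inner_smul_left, inner_smul_right, ← mul_assoc ((starRingEnd ℂ) r), e]
      push_cast; ring
    · rw [map_smul, norm_smul, hr1]; apply le_of_eq; ring
  have hs1 : ‖⟪x1, x2⟫_ℂ‖ < 1 := by
    refine lt_of_le_of_ne ?_ hdep
    have := norm_inner_le_norm (𝕜 := ℂ) x1 x2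
    rwa [h1, h2, one_mul] at this
  set s := ⟪x1, x2⟫_ℂ with hs
  obtain ⟨α, γ, w, hne, hN, hQ, hR⟩ : ∃ (α γ : ℝ) (w : ℂ), (α ≠ 0 ∨ γ ≠ 0 ∨ w ≠ 0) ∧
      α + γ + 2 * (w * s).re = 0 ∧
      (α : ℂ) * ⟪x1, B x1⟫_ℂ + γ * ⟪x2, B x2⟫_ℂ + w * ⟪x1, B x2⟫_ℂ
        + (starRingEnd ℂ) w * ⟪x2, B x1⟫_ℂ = 0 ∧
      0 ≤ α * ‖B x1‖^2 + γ * ‖B x2‖^2 + 2 * (w * ⟪B x1, B x2⟫_ℂ).re := by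
    obtain ⟨α, γ, w, hne, hN, hQ⟩ := hker s ⟪x1, B x1⟫_ℂ ⟪x2, B x2⟫_ℂ ⟪x1, B x2⟫_ℂ ⟪x2, B x1⟫_ℂ
    by_cases hR : 0 ≤ α * ‖B x1‖^2 + γ * ‖B x2‖^2 + 2 * (w * ⟪B x1, B x2⟫_ℂ).re
    · exact ⟨α, γ, w, hne, hN, hQ, hR⟩
    · refine ⟨-α, -γ, -w, by simpa using hne, ?_, ?_, ?_⟩
      · rw [neg_mul, Complex.neg_re]; linarith
      · rw [map_neg]; push_cast; linear_combination -hQ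
      · rw [neg_mul, neg_mul, neg_mul, Complex.neg_re]; push Not at hR; linarith
  have hws : ∀ w : ℂ, |(w * s).re| ≤ ‖w‖ * ‖s‖ := fun w => by
    rw [← norm_mul]; exact Complex.abs_re_le_norm _
  have hD : 0 < ‖w‖^2 - α * γ := by
    by_cases hw : w = 0
    · subst hw
      simp at hN hne ⊢
      have : γ = -α := by linarith
      subst this
      have : α ≠ 0 := by rcases hne with h | h <;> simpa using h
      have := mul_self_pos.2 this
      linarith
    · have hw' : 0 < ‖w‖ := norm_pos_iff.2 hw
      have h3 := hws w
      have h4 : |(w * s).re| < ‖w‖ := lt_of_le_of_lt h3 (by nlinarith)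
      have h5 := abs_lt.1 h4
      have h6 : (α + γ)^2 < (2 * ‖w‖)^2 := by
        apply sq_lt_sq' <;> linarith
      nlinarith [sq_nonneg (α - γ)]
  set D := ‖w‖^2 - α * γ with hDd
  set E := (1 - t) * γ + t * α with hE
  obtain ⟨τ, hτ0, hτ⟩ : ∃ τ : ℝ, 0 ≤ τ ∧ (1 - t + τ * α) * (t + τ * γ) = τ^2 * ‖w‖^2 := by
    have hF : 0 ≤ (1 - t) * t := mul_nonneg (by linarith) ht0
    set S := Real.sqrt (E^2 + 4 * D * ((1 - t) * t)) with hS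
    have hS2 : S^2 = E^2 + 4 * D * ((1 - t) * t) := Real.sq_sqrt (by positivity)
    have hSE : |E| ≤ S := Real.abs_le_sqrt (by nlinarith [mul_nonneg hD.le hF])
    refine ⟨(E + S) / (2 * D), div_nonneg (by linarith [neg_abs_le E]) (by linarith), ?_⟩
    set τ := (E + S) / (2 * D) with hτ
    have e1 : 2 * D * τ = E + S := by rw [hτ]; field_simp
    have e2 : (2 * D * τ - E)^2 = S^2 := by rw [e1]; ring
    have e3 : 4 * D * (D * τ^2 - E * τ - (1-t)*t) = 0 := by rw [hS2] at e2; linarith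
    have e4 : D * τ^2 - E * τ - (1-t)*t = 0 := by
      rcases mul_eq_zero.1 e3 with h | h
      · linarith
      · exact h
    rw [hDd, hE] at e4
    linarith
  set A1 := 1 - t + τ * α with hA1
  set A2 := t + τ * γ with hA2
  have hN1 : A1 + A2 + 2 * ((τ * w : ℂ) * s).re = 1 := by
    rw [mul_assoc, Complex.re_ofReal_mul]
    rw [hA1, hA2]; linear_combination τ * hN
  have hdet : A1 * A2 = ‖(τ * w : ℂ)‖^2 := by
    rw [hτ, norm_mul, mul_pow, Complex.norm_real, Real.norm_eq_abs, sq_abs]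
  have hpos : 0 ≤ A1 ∧ 0 ≤ A2 := by
    have hc : ¬ (A1 ≤ 0 ∧ A2 ≤ 0) := by
      rintro ⟨n1, n2⟩
      have h3 := hws (τ * w)
      have h4 : |((τ * w : ℂ) * s).re| ≤ ‖(τ * w : ℂ)‖ := le_trans h3 (by
        nlinarith [norm_nonneg (τ * w : ℂ)])
      have h5 : ‖(τ * w : ℂ)‖ * 2 ≤ -(A1 + A2) := by
        apply (sq_le_sq₀ (by positivity) (by linarith)).1
        nlinarith [sq_nonneg (A1 - A2)]
      have := (abs_le.1 h4).2
      linarith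
    have h0 : 0 ≤ A1 * A2 := by rw [hdet]; positivity
    rcases mul_nonneg_iff.1 h0 with h | h
    · exact h
    · exact absurd h hc
  obtain ⟨c1, c2, hc1, hc2, hc⟩ := rank2 A1 A2 (τ * w) hpos.1 hpos.2 hdet
  refine ⟨c1 • x1 + c2 • x2, ?_, ?_, ?_⟩
  · have := form_expand (ContinuousLinearMap.id ℂ H) (ContinuousLinearMap.id ℂ H) x1 x2 c1 c2
    simp only [ContinuousLinearMap.id_apply] at this
    have h3 := congrArg Complex.re this
    rw [hc1, hc2, hc, inner_self_eq_norm_sq_to_K, inner_self_eq_norm_sq_to_K,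
      inner_self_eq_norm_sq_to_K, ← inner_conj_symm x2 x1, ← map_mul, h1, h2] at h3
    have h4 : ‖c1 • x1 + c2 • x2‖^2 = 1 := by
      rw [← hN1]
      simp only [Complex.add_re, Complex.conj_re, hs.symm] at h3
      norm_cast at h3
      simp [← Complex.ofReal_pow] at h3 ⊢
      linarith
    have := norm_nonneg (c1 • x1 + c2 • x2)
    nlinarith
  · have := form_expand (ContinuousLinearMap.id ℂ H) B x1 x2 c1 c2
    simp only [ContinuousLinearMap.id_apply] at this
    rw [this, hc1, hc2, hc, hA1, hA2, map_mul, Complex.conj_ofReal]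
    push_cast
    linear_combination (τ : ℂ) * hQ
  · have := form_expand B B x1 x2 c1 c2
    have h3 := congrArg Complex.re this
    rw [hc1, hc2, hc, inner_self_eq_norm_sq_to_K, inner_self_eq_norm_sq_to_K,
      inner_self_eq_norm_sq_to_K, ← inner_conj_symm (B x2) (B x1), ← map_mul] at h3
    simp only [Complex.add_re, Complex.conj_re, mul_assoc, Complex.re_ofReal_mul] at h3
    norm_cast at h3
    have h4 := mul_nonneg hτ0 hR
    rw [hA1, hA2] at h3
    simp only [RCLike.ofReal_pow, Complex.coe_algebraMap, ← Complex.ofReal_pow, Complex.ofReal_re] at h3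
    nlinarith

end convexity

end Part3

section Part4
open scoped InnerProductSpace

section convexity2
variable {H : Type*} [NormedAddCommGroup H] [InnerProductSpace ℂ H]

theorem perp_inner (ξ u η : H) (hξ : ‖ξ‖ = 1) :
    ⟪u - ⟪ξ, u⟫_ℂ • ξ, η - ⟪ξ, η⟫_ℂ • ξ⟫_ℂ = ⟪u, η⟫_ℂ - ⟪u, ξ⟫_ℂ * ⟪ξ, η⟫_ℂ := by
  have h : ⟪ξ, ξ⟫_ℂ = 1 := by rw [inner_self_eq_norm_sq_to_K, hξ]; simp
  simp only [inner_sub_left, inner_sub_right, inner_smul_left, inner_smul_right, h,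
    inner_conj_symm]
  ring

theorem perp_norm (ξ u : H) (hξ : ‖ξ‖ = 1) :
    ‖u - ⟪ξ, u⟫_ℂ • ξ‖^2 = ‖u‖^2 - ‖⟪u, ξ⟫_ℂ‖^2 := by
  have h := perp_inner ξ u u hξ
  rw [inner_self_eq_norm_sq_to_K, inner_self_eq_norm_sq_to_K, ← inner_conj_symm ξ u,
    Complex.mul_conj'] at h
  simp only [Complex.coe_algebraMap] at h
  rw [inner_conj_symm] at h
  exact_mod_cast h

theorem bnd (ξ u η : H) (hξ : ‖ξ‖ = 1) :
    ‖⟪u, η⟫_ℂ - ⟪u, ξ⟫_ℂ * ⟪ξ, η⟫_ℂ‖^2 ≤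
      (‖u‖^2 - ‖⟪u, ξ⟫_ℂ‖^2) * (‖η‖^2 - ‖⟪ξ, η⟫_ℂ‖^2) := by
  have e : ‖⟪ξ, η⟫_ℂ‖ = ‖⟪η, ξ⟫_ℂ‖ := norm_inner_symm _ _
  rw [e, ← perp_norm ξ u hξ, ← perp_norm ξ η hξ, ← perp_inner ξ u η hξ, ← mul_pow]
  exact pow_le_pow_left₀ (norm_nonneg _) (norm_inner_le_norm _ _) 2

theorem mixnorm (t : ℝ) (p1 p2 : ℂ) :
    ‖((1 - t : ℝ) : ℂ) * p1 + (t : ℂ) * p2‖^2 =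
      (1 - t) * ‖p1‖^2 + t * ‖p2‖^2 - t * (1 - t) * ‖p2 - p1‖^2 := by
  simp only [← Complex.normSq_eq_norm_sq, Complex.normSq_apply]
  simp
  ring

theorem cs3 (k1 k2 k3 a1 a2 a3 b1 b2 b3 : ℝ) (h1 : 0 ≤ k1) (h2 : 0 ≤ k2) (h3 : 0 ≤ k3) :
    (k1 * (a1 * b1) + k2 * (a2 * b2) + k3 * (a3 * b3))^2 ≤
      (k1 * a1^2 + k2 * a2^2 + k3 * a3^2) * (k1 * b1^2 + k2 * b2^2 + k3 * b3^2) := by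
  have e1 := mul_nonneg (mul_nonneg h1 h2) (sq_nonneg (a1 * b2 - a2 * b1))
  have e2 := mul_nonneg (mul_nonneg h1 h3) (sq_nonneg (a1 * b3 - a3 * b1))
  have e3 := mul_nonneg (mul_nonneg h2 h3) (sq_nonneg (a2 * b3 - a3 * b2))
  linarith

theorem mixbnd (t : ℝ) (ht0 : 0 ≤ t) (ht1 : t ≤ 1) (p1 p2 q1 q2 z1 z2 : ℂ)
    (P1 P2 R1 R2 P R : ℝ)
    (hP1 : ‖p1‖^2 ≤ P1) (hP2 : ‖p2‖^2 ≤ P2) (hR1 : ‖q1‖^2 ≤ R1) (hR2 : ‖q2‖^2 ≤ R2)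
    (h1 : ‖z1 - p1 * q1‖^2 ≤ (P1 - ‖p1‖^2) * (R1 - ‖q1‖^2))
    (h2 : ‖z2 - p2 * q2‖^2 ≤ (P2 - ‖p2‖^2) * (R2 - ‖q2‖^2))
    (hP : (1 - t) * P1 + t * P2 ≤ P) (hR : (1 - t) * R1 + t * R2 ≤ R)
    (p q z : ℂ) (hp : p = ((1 - t : ℝ) : ℂ) * p1 + (t : ℂ) * p2)
    (hq : q = ((1 - t : ℝ) : ℂ) * q1 + (t : ℂ) * q2)
    (hz : z = ((1 - t : ℝ) : ℂ) * z1 + (t : ℂ) * z2) :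
    ‖z - p * q‖^2 ≤ (P - ‖p‖^2) * (R - ‖q‖^2) := by
  have k3 : 0 ≤ t * (1 - t) := mul_nonneg ht0 (by linarith)
  have k1 : 0 ≤ 1 - t := by linarith
  have e : z - p * q = ((1 - t : ℝ) : ℂ) * (z1 - p1 * q1) + (t : ℂ) * (z2 - p2 * q2) +
      ((t * (1 - t) : ℝ) : ℂ) * ((p2 - p1) * (q2 - q1)) := by
    rw [hp, hq, hz]; push_cast; ring
  have s1 := Real.sq_sqrt (sub_nonneg.2 hP1)
  have s2 := Real.sq_sqrt (sub_nonneg.2 hP2)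
  have r1 := Real.sq_sqrt (sub_nonneg.2 hR1)
  have r2 := Real.sq_sqrt (sub_nonneg.2 hR2)
  have s1' := Real.sqrt_nonneg (P1 - ‖p1‖^2)
  have s2' := Real.sqrt_nonneg (P2 - ‖p2‖^2)
  have r1' := Real.sqrt_nonneg (R1 - ‖q1‖^2)
  have r2' := Real.sqrt_nonneg (R2 - ‖q2‖^2)
  set σ1 := Real.sqrt (P1 - ‖p1‖^2)
  set σ2 := Real.sqrt (P2 - ‖p2‖^2)
  set ρ1 := Real.sqrt (R1 - ‖q1‖^2)
  set ρ2 := Real.sqrt (R2 - ‖q2‖^2)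
  have b1 : ‖z1 - p1 * q1‖ ≤ σ1 * ρ1 := by
    apply (sq_le_sq₀ (norm_nonneg _) (by positivity)).1
    rw [mul_pow, s1, r1]; exact h1
  have b2 : ‖z2 - p2 * q2‖ ≤ σ2 * ρ2 := by
    apply (sq_le_sq₀ (norm_nonneg _) (by positivity)).1
    rw [mul_pow, s2, r2]; exact h2
  have n1 : ‖z - p * q‖ ≤ (1 - t) * (σ1 * ρ1) + t * (σ2 * ρ2) +
      t * (1 - t) * (‖p2 - p1‖ * ‖q2 - q1‖) := by
    rw [e]
    refine (norm_add₃_le).trans ?_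
    rw [norm_mul, norm_mul, norm_mul, norm_mul, Complex.norm_real, Complex.norm_real,
      Complex.norm_real, Real.norm_of_nonneg k1, Real.norm_of_nonneg ht0,
      Real.norm_of_nonneg k3]
    gcongr
  have c := cs3 (1 - t) t (t * (1 - t)) σ1 σ2 ‖p2 - p1‖ ρ1 ρ2 ‖q2 - q1‖ k1 ht0 k3
  have f1 : (1 - t) * σ1^2 + t * σ2^2 + t * (1 - t) * ‖p2 - p1‖^2 ≤ P - ‖p‖^2 := by
    rw [hp, mixnorm, s1, s2]; linarith
  have f2 : (1 - t) * ρ1^2 + t * ρ2^2 + t * (1 - t) * ‖q2 - q1‖^2 ≤ R - ‖q‖^2 := by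
    rw [hq, mixnorm, r1, r2]; linarith
  refine (pow_le_pow_left₀ (norm_nonneg _) n1 2).trans (c.trans ?_)
  have g1 : 0 ≤ (1 - t) * σ1^2 + t * σ2^2 + t * (1 - t) * ‖p2 - p1‖^2 := by positivity
  have g2 : 0 ≤ (1 - t) * ρ1^2 + t * ρ2^2 + t * (1 - t) * ‖q2 - q1‖^2 := by positivity
  exact mul_le_mul f1 f2 g2 (g1.trans f1)

/-- attaining vector -/
theorem attain (ξ u y : H) (hξ : ‖ξ‖ = 1) (q z : ℂ) (R : ℝ)
    (hR : ‖q‖^2 ≤ R)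
    (hb : ‖z - ⟪u, ξ⟫_ℂ * q‖^2 ≤ (‖u‖^2 - ‖⟪u, ξ⟫_ℂ‖^2) * (R - ‖q‖^2))
    (hy1 : ⟪ξ, y⟫_ℂ = 0) (hy2 : ⟪u, y⟫_ℂ = 0)
    (hy : ‖y‖ = 1 ∨ R = ‖q‖^2 ∨ ((‖u‖^2 - ‖⟪u, ξ⟫_ℂ‖^2) ≠ 0 ∧
      ‖z - ⟪u, ξ⟫_ℂ * q‖^2 = (‖u‖^2 - ‖⟪u, ξ⟫_ℂ‖^2) * (R - ‖q‖^2))) :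
    ∃ η : H, ‖η‖^2 = R ∧ ⟪ξ, η⟫_ℂ = q ∧ ⟪u, η⟫_ℂ = z := by
  set p := ⟪u, ξ⟫_ℂ with hp
  set u' := u - ⟪ξ, u⟫_ℂ • ξ with hu'
  have hS : ‖u'‖^2 = ‖u‖^2 - ‖p‖^2 := perp_norm ξ u hξ
  rw [← hS] at hb hy
  have hξξ : ⟪ξ, ξ⟫_ℂ = 1 := by rw [inner_self_eq_norm_sq_to_K, hξ]; simp
  have o1 : ⟪ξ, u'⟫_ℂ = 0 := by
    rw [hu', inner_sub_right, inner_smul_right, hξξ]; ring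
  have o1' : ⟪u', ξ⟫_ℂ = 0 := by rw [← inner_conj_symm, o1]; simp
  have o2 : ⟪u', y⟫_ℂ = 0 := by
    rw [hu', inner_sub_left, inner_smul_left, hy1, hy2]; simp
  have o3 : ⟪u', u'⟫_ℂ = ((‖u'‖^2 : ℝ) : ℂ) := by
    rw [inner_self_eq_norm_sq_to_K]; simp
  have o4 : ⟪u, u'⟫_ℂ = ((‖u'‖^2 : ℝ) : ℂ) := by
    rw [← o3]; nth_rw 2 [hu']; rw [inner_sub_left, inner_smul_left, o1]; simp
  set μ : ℂ := (z - p * q) / ((‖u'‖^2 : ℝ) : ℂ) with hμ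
  have hμ1 : μ * ((‖u'‖^2 : ℝ) : ℂ) = z - p * q := by
    by_cases h0 : ‖u'‖^2 = 0
    · rw [h0] at hb ⊢
      have : ‖z - p * q‖^2 = 0 := le_antisymm (by simpa using hb) (by positivity)
      have : z - p * q = 0 := by simpa using this
      rw [this]; simp
    · rw [hμ]; exact div_mul_cancel₀ _ (by exact_mod_cast h0)
  have hμ2 : ‖μ‖^2 * ‖u'‖^2 * ‖u'‖^2 = ‖z - p * q‖^2 := by
    rw [← hμ1, norm_mul, mul_pow, Complex.norm_real, Real.norm_of_nonneg (by positivity)]; ring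
  have hμ0 : ‖u'‖^2 = 0 → μ = 0 := fun h => by rw [hμ, h]; simp
  have hμ3 : ‖μ‖^2 * ‖u'‖^2 ≤ R - ‖q‖^2 := by
    by_cases h0 : ‖u'‖^2 = 0
    · rw [h0]; simpa using hR
    · have : 0 < ‖u'‖^2 := lt_of_le_of_ne (by positivity) (Ne.symm h0)
      rw [← hμ2, mul_comm] at hb
      exact le_of_mul_le_mul_left hb this
  have hν : 0 ≤ R - ‖q‖^2 - ‖μ‖^2 * ‖u'‖^2 := by linarith
  set ν := Real.sqrt (R - ‖q‖^2 - ‖μ‖^2 * ‖u'‖^2) with hνd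
  have hν2 : ν^2 = R - ‖q‖^2 - ‖μ‖^2 * ‖u'‖^2 := Real.sq_sqrt hν
  have hνy : ν^2 * ‖y‖^2 = ν^2 := by
    rcases hy with hy | hy | ⟨h0, h1⟩
    · rw [hy]; ring
    · have : ν^2 = 0 := le_antisymm (by rw [hν2, hy]; nlinarith [mul_nonneg (sq_nonneg ‖μ‖) (sq_nonneg ‖u'‖)]) (by positivity)
      rw [this]; ring
    · have : ν^2 = 0 := by
        rw [← hμ2, mul_comm] at h1
        have := mul_left_cancel₀ h0 h1
        rw [hν2, this]; ring
      rw [this]; ring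
  refine ⟨q • ξ + (μ • u' + (ν : ℂ) • y), ?_, ?_, ?_⟩
  · have a1 : ⟪q • ξ, μ • u' + (ν : ℂ) • y⟫_ℂ = 0 := by
      simp [inner_smul_left, inner_add_right, inner_smul_right, o1, hy1]
    have a2 : ⟪μ • u', (ν : ℂ) • y⟫_ℂ = 0 := by
      simp [inner_smul_left, inner_smul_right, o2]
    have b1 := norm_add_sq_eq_norm_sq_add_norm_sq_of_inner_eq_zero _ _ a1
    have b2 := norm_add_sq_eq_norm_sq_add_norm_sq_of_inner_eq_zero _ _ a2
    rw [norm_smul] at b1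
    rw [norm_smul, norm_smul, Complex.norm_real, Real.norm_of_nonneg (Real.sqrt_nonneg _)] at b2
    rw [hξ] at b1
    nlinarith
  · simp [inner_add_right, inner_smul_right, o1, hy1, hξ]
  · simp only [inner_add_right, inner_smul_right, hy2, o4, ← hp]
    rw [hμ1]; ring

def TSet (c b : H →L[ℂ] H) : Set ℂ :=
  {z | ∃ x ξ η : H, ‖x‖ = 1 ∧ ‖ξ‖ = 1 ∧ ‖η‖ = ‖b x‖ ∧ ⟪ξ, η⟫_ℂ = ⟪x, b x⟫_ℂ ∧ z = ⟪c ξ, η⟫_ℂ}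

theorem q_le (b : H →L[ℂ] H) (x : H) (hx : ‖x‖ = 1) : ‖⟪x, b x⟫_ℂ‖^2 ≤ ‖b x‖^2 := by
  apply pow_le_pow_left₀ (norm_nonneg _)
  have := norm_inner_le_norm (𝕜 := ℂ) x (b x)
  rwa [hx, one_mul] at this

theorem TSet_convex (c b : H →L[ℂ] H) : Convex ℝ (TSet c b) := by
  rw [convex_iff_forall_pos]
  rintro z1 ⟨x1, ξ1, η1, hx1, hξ1, hη1, hq1, hz1⟩ z2 ⟨x2, ξ2, η2, hx2, hξ2, hη2, hq2, hz2⟩ r t hr ht hrt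
  have hr' : r = 1 - t := by linarith
  subst hr'
  obtain ⟨x, hx, hxq, hxR⟩ := DWup b x1 x2 hx1 hx2 t ht.le (by linarith)
  obtain ⟨ξ, hξ, hξq, hξR⟩ := DWup c ξ1 ξ2 hξ1 hξ2 t ht.le (by linarith)
  have hpc : ⟪c ξ, ξ⟫_ℂ = ((1 - t : ℝ) : ℂ) * ⟪c ξ1, ξ1⟫_ℂ + (t : ℂ) * ⟪c ξ2, ξ2⟫_ℂ := by
    have := congrArg (starRingEnd ℂ) hξq
    simpa [inner_conj_symm] using this
  have hsym : ∀ ξ : H, ‖ξ‖ = 1 → ‖⟪c ξ, ξ⟫_ℂ‖^2 ≤ ‖c ξ‖^2 := fun ξ h => by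
    rw [norm_inner_symm]; exact q_le c ξ h
  set z := ((1 - t : ℝ) : ℂ) * z1 + (t : ℂ) * z2 with hz
  have hzz : (1 - t) • z1 + t • z2 = z := by rw [hz]; simp
  rw [hzz]
  have key : ‖z - ⟪c ξ, ξ⟫_ℂ * ⟪x, b x⟫_ℂ‖^2 ≤
      (‖c ξ‖^2 - ‖⟪c ξ, ξ⟫_ℂ‖^2) * (‖b x‖^2 - ‖⟪x, b x⟫_ℂ‖^2) := by
    refine mixbnd t ht.le (by linarith) ⟪c ξ1, ξ1⟫_ℂ ⟪c ξ2, ξ2⟫_ℂ ⟪x1, b x1⟫_ℂ ⟪x2, b x2⟫_ℂ z1 z2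
      (‖c ξ1‖^2) (‖c ξ2‖^2) (‖b x1‖^2) (‖b x2‖^2) _ _ (hsym _ hξ1) (hsym _ hξ2)
      (q_le b x1 hx1) (q_le b x2 hx2) ?_ ?_ hξR hxR _ _ _ hpc hxq hz
    · have := bnd ξ1 (c ξ1) η1 hξ1
      rwa [hη1, hq1, ← hz1] at this
    · have := bnd ξ2 (c ξ2) η2 hξ2
      rwa [hη2, hq2, ← hz2] at this
  have fin : ∀ x : H, ‖x‖ = 1 → (∃ η : H, ‖η‖^2 = ‖b x‖^2 ∧ ⟪ξ, η⟫_ℂ = ⟪x, b x⟫_ℂ ∧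
      ⟪c ξ, η⟫_ℂ = z) → z ∈ TSet c b := by
    rintro x hx ⟨η, h1, h2, h3⟩
    refine ⟨x, ξ, η, hx, hξ, ?_, h2, h3.symm⟩
    exact (sq_eq_sq₀ (norm_nonneg _) (norm_nonneg _)).1 h1
  by_cases hβ : ‖b x‖^2 = ‖⟪x, b x⟫_ℂ‖^2
  · exact fin x hx (attain ξ (c ξ) 0 hξ _ z _ (q_le b x hx) key (by simp) (by simp) (Or.inr (Or.inl hβ)))
  by_cases h3 : ∃ y : H, ‖y‖ = 1 ∧ ⟪ξ, y⟫_ℂ = 0 ∧ ⟪c ξ, y⟫_ℂ = 0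
  · obtain ⟨y, hy, hy1, hy2⟩ := h3
    exact fin x hx (attain ξ (c ξ) y hξ _ z _ (q_le b x hx) key hy1 hy2 (Or.inl hy))
  have h3' : ∀ y : H, ⟪ξ, y⟫_ℂ = 0 → ⟪c ξ, y⟫_ℂ = 0 → y = 0 := by
    intro y h1 h2
    by_contra h0
    refine h3 ⟨((‖y‖⁻¹ : ℝ) : ℂ) • y, ?_, by simp [inner_smul_right, h1], by simp [inner_smul_right, h2]⟩
    rw [norm_smul, Complex.norm_real, norm_inv, norm_norm]
    exact inv_mul_cancel₀ (norm_ne_zero_iff.2 h0)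
  by_cases hS : ‖c ξ‖^2 - ‖⟪c ξ, ξ⟫_ℂ‖^2 = 0
  · exfalso
    rw [← perp_norm ξ (c ξ) hξ] at hS
    have h0 : c ξ - ⟪ξ, c ξ⟫_ℂ • ξ = 0 := by simpa using hS
    have hcξ : c ξ = ⟪ξ, c ξ⟫_ℂ • ξ := sub_eq_zero.1 h0
    have hξξ : ⟪ξ, ξ⟫_ℂ = 1 := by rw [inner_self_eq_norm_sq_to_K, hξ]; simp
    have hv : ∀ v : H, v = ⟪ξ, v⟫_ℂ • ξ := by
      intro v
      have e1 : ⟪ξ, v - ⟪ξ, v⟫_ℂ • ξ⟫_ℂ = 0 := by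
        rw [inner_sub_right, inner_smul_right, hξξ]; ring
      refine sub_eq_zero.1 (h3' _ e1 ?_)
      rw [hcξ, inner_smul_left, e1, mul_zero]
    apply hβ
    have e2 : ‖⟪ξ, x⟫_ℂ‖ = 1 := by
      have := congrArg norm (hv x)
      rwa [hx, norm_smul, hξ, mul_one, eq_comm] at this
    have e3 : ‖b x‖ = ‖⟪ξ, b x⟫_ℂ‖ := by
      have := congrArg norm (hv (b x))
      rwa [norm_smul, hξ, mul_one] at this
    rw [e3]
    have e4 : ⟪x, b x⟫_ℂ = (starRingEnd ℂ) ⟪ξ, x⟫_ℂ * ⟪ξ, b x⟫_ℂ := by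
      conv_lhs => rw [hv x]
      rw [inner_smul_left, ← hv x]
    rw [e4, norm_mul, RCLike.norm_conj, e2, one_mul]
  · -- two dimensional case
    have hfd : FiniteDimensional ℂ H := by
      have htop : Submodule.span ℂ ({ξ, c ξ - ⟪ξ, c ξ⟫_ℂ • ξ} : Set H) = ⊤ := by
        rw [eq_top_iff]
        intro v _
        set u' := c ξ - ⟪ξ, c ξ⟫_ℂ • ξ with hu'
        have hξξ : ⟪ξ, ξ⟫_ℂ = 1 := by rw [inner_self_eq_norm_sq_to_K, hξ]; simp
        have o1 : ⟪ξ, u'⟫_ℂ = 0 := by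
          rw [hu', inner_sub_right, inner_smul_right, hξξ]; ring
        have hS' : ⟪u', u'⟫_ℂ ≠ 0 := by
          rw [← perp_norm ξ (c ξ) hξ] at hS
          rw [inner_self_ne_zero]
          rintro h
          rw [← hu', h] at hS; simp at hS
        have o1' : ⟪u', ξ⟫_ℂ = 0 := by rw [← inner_conj_symm, o1]; simp
        set y := v - ⟪ξ, v⟫_ℂ • ξ - (⟪u', v⟫_ℂ / ⟪u', u'⟫_ℂ) • u' with hy
        have e1 : ⟪ξ, y⟫_ℂ = 0 := by
          rw [hy, inner_sub_right, inner_sub_right, inner_smul_right, inner_smul_right, hξξ, o1]; ring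
        have e2 : ⟪u', y⟫_ℂ = 0 := by
          rw [hy, inner_sub_right, inner_sub_right, inner_smul_right, inner_smul_right, o1']
          field_simp; ring
        have e3 : ⟪c ξ, y⟫_ℂ = 0 := by
          have : c ξ = u' + ⟪ξ, c ξ⟫_ℂ • ξ := by rw [hu']; abel
          rw [this, inner_add_left, inner_smul_left, e1, e2]; simp
        have h0 := h3' y e1 e3
        have : v = ⟪ξ, v⟫_ℂ • ξ + (⟪u', v⟫_ℂ / ⟪u', u'⟫_ℂ) • u' := by
          rw [hy, sub_sub, sub_eq_zero] at h0; exact h0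
        rw [this]
        exact Submodule.add_mem _ (Submodule.smul_mem _ _ (Submodule.subset_span (by simp)))
          (Submodule.smul_mem _ _ (Submodule.subset_span (by simp)))
      refine ⟨⟨(Set.Finite.toFinset (s := ({ξ, c ξ - ⟪ξ, c ξ⟫_ℂ • ξ} : Set H)) (by simp)), by simpa using htop⟩⟩
    have hnt : Nontrivial H := ⟨x, 0, by intro h; rw [h] at hx; simp at hx⟩
    obtain ⟨lam, hlam⟩ := Module.End.exists_eigenvalue (b : H →ₗ[ℂ] H)
    obtain ⟨v, hv⟩ := hlam.exists_hasEigenvector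
    have hv0 : v ≠ 0 := hv.2
    have hbv : b v = lam • v := hv.apply_eq_smul
    set x0 : H := ((‖v‖⁻¹ : ℝ) : ℂ) • v with hx0d
    have hx0 : ‖x0‖ = 1 := by
      rw [hx0d, norm_smul, Complex.norm_real, norm_inv, norm_norm]
      exact inv_mul_cancel₀ (norm_ne_zero_iff.2 hv0)
    have hbx0 : b x0 = lam • x0 := by
      rw [hx0d, map_smul, hbv, smul_comm]
    let g : H → ℝ := fun y => ‖z - ⟪c ξ, ξ⟫_ℂ * ⟪y, b y⟫_ℂ‖^2 -
      (‖c ξ‖^2 - ‖⟪c ξ, ξ⟫_ℂ‖^2) * (‖b y‖^2 - ‖⟪y, b y⟫_ℂ‖^2)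
    have hg : Continuous g := by
      have : Continuous fun y => ⟪y, b y⟫_ℂ := continuous_id.inner b.continuous
      have := b.continuous
      fun_prop
    have hg0 : 0 ≤ g x0 := by
      have : ‖b x0‖^2 - ‖⟪x0, b x0⟫_ℂ‖^2 = 0 := by
        rw [hbx0, norm_smul, inner_smul_right, inner_self_eq_norm_sq_to_K, hx0]; simp
      simp only [g]
      rw [this, mul_zero, sub_zero]; positivity
    have hgx : g x ≤ 0 := by simp only [g]; linarith
    have hrk : 1 < Module.rank ℝ H := by
      rw [rank_real_of_complex]
      have : 1 ≤ Module.rank ℂ H := by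
        rw [Cardinal.one_le_iff_pos]; exact rank_pos
      calc (1 : Cardinal) < 2 := by norm_num
        _ = 2 * 1 := by norm_num
        _ ≤ _ := by gcongr
    obtain ⟨y, hy, hgy⟩ := (isPreconnected_sphere hrk (0 : H) 1).intermediate_value
      (a := x) (b := x0) (by simpa using hx) (by simpa using hx0) hg.continuousOn ⟨hgx, hg0⟩
    have hy1 : ‖y‖ = 1 := by simpa using hy
    have hgy' : ‖z - ⟪c ξ, ξ⟫_ℂ * ⟪y, b y⟫_ℂ‖^2 =
      (‖c ξ‖^2 - ‖⟪c ξ, ξ⟫_ℂ‖^2) * (‖b y‖^2 - ‖⟪y, b y⟫_ℂ‖^2) := sub_eq_zero.1 hgy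
    exact fin y hy1 (attain ξ (c ξ) 0 hξ _ z _ (q_le b y hy1) hgy'.le (by simp) (by simp)
      (Or.inr (Or.inr ⟨hS, hgy'⟩)))

end convexity2

end Part4

section Part5
open scoped InnerProductSpace ComplexOrder

section states
universe u
variable {A : Type u} [CStarAlgebra A]

def IsExt (p : A) (φ : A →L[ℂ] ℂ) : Prop :=
  (‖φ‖ ≤ 1 ∧ φ p = ‖p‖) ∧ ∀ φ1 φ2 : A →L[ℂ] ℂ, ‖φ1‖ ≤ 1 → φ1 p = ‖p‖ → ‖φ2‖ ≤ 1 → φ2 p = ‖p‖ →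
    ∀ s : ℝ, 0 < s → s < 1 → (∀ a, φ a = s * φ1 a + (1 - s : ℝ) * φ2 a) → φ1 = φ

theorem exists_ext (p : A) : ∃ φ : A →L[ℂ] ℂ, IsExt p φ := by
  let F : Set (A → ℂ) := ((fun f : A →L[ℂ] ℂ => (f : A → ℂ)) '' Metric.closedBall 0 1) ∩ {f | f p = ‖p‖}
  have hc : IsCompact F := by
    refine (ContinuousLinearMap.isCompact_image_coe_closedBall (0 : A →L[ℂ] ℂ) 1).inter_right ?_
    exact isClosed_eq (continuous_apply p) continuous_const
  have hne : F.Nonempty := by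
    obtain ⟨g, hg, hgp⟩ := exists_dual_vector'' ℂ p
    exact ⟨g, ⟨g, by simpa using hg, rfl⟩, hgp⟩
  obtain ⟨f, hf⟩ := hc.extremePoints_nonempty hne
  obtain ⟨⟨φ, hφ, rfl⟩, hφp⟩ := hf.1
  refine ⟨φ, ⟨by simpa using hφ, hφp⟩, ?_⟩
  intro φ1 φ2 h1 h1p h2 h2p s hs0 hs1 h
  have := hf.2 (x₁ := (φ1 : A → ℂ)) ⟨⟨φ1, by simpa using h1, rfl⟩, h1p⟩
    (x₂ := (φ2 : A → ℂ)) ⟨⟨φ2, by simpa using h2, rfl⟩, h2p⟩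
    ⟨s, 1 - s, hs0, by linarith, by ring, by
      funext a
      simp [h a]⟩
  exact DFunLike.coe_injective this

theorem IsExt.split {p : A} (hp : p ≠ 0) {φ : A →L[ℂ] ℂ} (h : IsExt p φ) (φ1 φ2 : A →L[ℂ] ℂ) (s : ℝ)
    (hs0 : 0 ≤ s) (hs1 : s ≤ 1) (h1 : ∀ a, ‖φ1 a‖ ≤ s * ‖a‖) (h2 : ∀ a, ‖φ2 a‖ ≤ (1 - s) * ‖a‖)
    (hφ : ∀ a, φ a = φ1 a + φ2 a) : ∀ a, φ1 a = s * φ a := by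
  rcases hs0.eq_or_lt with h0 | h0
  · intro a
    have := h1 a
    rw [← h0, zero_mul] at this
    have := norm_le_zero_iff.1 this
    rw [this, ← h0]; simp
  rcases hs1.eq_or_lt with h0' | h0'
  · intro a
    have := h2 a
    rw [h0', sub_self, zero_mul] at this
    have := norm_le_zero_iff.1 this
    rw [hφ a, this, h0']; simp
  have hsum : φ1 p + φ2 p = ‖p‖ := by rw [← hφ, h.1.2]
  have hre := congrArg Complex.re hsum
  simp only [Complex.add_re, Complex.ofReal_re] at hre
  have r1 := (Complex.re_le_norm (φ1 p)).trans (h1 p)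
  have r2 := (Complex.re_le_norm (φ2 p)).trans (h2 p)
  have aux : ∀ (w : ℂ) (r : ℝ), ‖w‖ ≤ r → w.re = r → w = r := by
    intro w r hw hr
    have : w.re = ‖w‖ := le_antisymm (Complex.re_le_norm w) (by rw [hr]; exact hw)
    have h4 := Complex.re_eq_norm.1 this
    have := (Complex.nonneg_iff.1 h4).2
    apply Complex.ext
    · simpa using hr
    · simpa using this.symm
  have p1 := aux _ _ (h1 p) (by linarith)
  have p2 := aux _ _ (h2 p) (by linarith)
  have hs' : (s : ℂ) ≠ 0 := by exact_mod_cast h0.ne'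
  have hs'' : (1 - s : ℝ) ≠ 0 := by linarith
  have hs3 : ((1 - s : ℝ) : ℂ) ≠ 0 := by exact_mod_cast hs''
  have := h.2 ((s : ℂ)⁻¹ • φ1) (((1 - s : ℝ) : ℂ)⁻¹ • φ2) ?_ ?_ ?_ ?_ s h0 h0' ?_
  · intro a
    rw [← this]
    simp [hs']
  · refine ContinuousLinearMap.opNorm_le_bound _ zero_le_one fun a => ?_
    simp only [ContinuousLinearMap.smul_apply, norm_smul, norm_inv, Complex.norm_real, Real.norm_of_nonneg hs0]
    rw [inv_mul_le_iff₀ h0, one_mul]; exact h1 a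
  · simp only [ContinuousLinearMap.smul_apply, smul_eq_mul, p1]
    push_cast; field_simp
  · refine ContinuousLinearMap.opNorm_le_bound _ zero_le_one fun a => ?_
    simp only [ContinuousLinearMap.smul_apply, norm_smul, norm_inv, Complex.norm_real, Real.norm_of_nonneg (sub_nonneg.2 hs1)]
    rw [inv_mul_le_iff₀ (by linarith), one_mul]; exact h2 a
  · simp only [ContinuousLinearMap.smul_apply, smul_eq_mul, p2]
    push_cast
    push_cast at hs3
    field_simp
  · intro a
    simp only [ContinuousLinearMap.smul_apply, smul_eq_mul]
    rw [mul_inv_cancel_left₀ hs', mul_inv_cancel_left₀ hs3, hφ a]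

attribute [local instance] CStarAlgebra.spectralOrder CStarAlgebra.spectralOrderedRing

theorem state_sa (φ : A →L[ℂ] ℂ) (h : ‖φ‖ ≤ 1) (h1 : φ 1 = 1) (a : A) (ha : IsSelfAdjoint a) :
    (φ a).im = 0 := by
  have key : ∀ s : ℝ, (φ a).im * (2 * s) ≤ ‖a‖^2 := by
    intro s
    have e1 : ‖φ (a + (Complex.I * s) • (1 : A))‖ ≤ ‖a + (Complex.I * s) • (1 : A)‖ := by
      refine (φ.le_opNorm _).trans ?_
      exact mul_le_of_le_one_left (norm_nonneg _) h
    have e2 : ‖a + (Complex.I * s) • (1 : A)‖^2 ≤ ‖a‖^2 + s^2 := by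
      rw [sq, ← CStarRing.norm_star_mul_self]
      have : star (a + (Complex.I * s) • (1 : A)) * (a + (Complex.I * s) • (1 : A)) =
          a * a + ((s : ℂ)^2) • (1 : A) := by
        rw [star_add, star_smul, star_one, ha.star_eq]
        simp only [add_mul, mul_add, smul_mul_assoc, mul_smul_comm, one_mul, mul_one, smul_add, smul_smul,
          star_mul', Complex.star_def, Complex.conj_I, Complex.conj_ofReal]
        have : Complex.I * s * (-Complex.I * s) = (s : ℂ)^2 := by
          linear_combination (-(s:ℂ)^2) * Complex.I_sq
        rw [this]
        have e : (-Complex.I * (s:ℂ)) • a = -((Complex.I * s) • a) := by rw [← neg_smul]; ring_nf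
        rw [e]; abel
      rw [this]
      refine (norm_add_le _ _).trans ?_
      have a1 : ‖a * a‖ ≤ ‖a‖^2 := by rw [sq]; exact norm_mul_le _ _
      have a2 : ‖((s : ℂ)^2) • (1 : A)‖ ≤ s^2 := by
        rw [norm_smul, norm_pow, Complex.norm_real, Real.norm_eq_abs, sq_abs]
        have : ‖(1 : A)‖ ≤ 1 := by
          rcases subsingleton_or_nontrivial A with hh | hh
          · simp [Subsingleton.elim (1 : A) 0]
          · simp
        nlinarith [sq_nonneg s]
      linarith
    have e3 : φ (a + (Complex.I * s) • (1 : A)) = φ a + Complex.I * s := by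
      rw [map_add, map_smul, h1, smul_eq_mul, mul_one]
    rw [e3] at e1
    have e4 : ‖φ a + Complex.I * s‖^2 = (φ a).re^2 + ((φ a).im + s)^2 := by
      rw [← Complex.normSq_eq_norm_sq, Complex.normSq_apply]; simp; ring
    have e5 := pow_le_pow_left₀ (norm_nonneg _) e1 2
    nlinarith [sq_nonneg (φ a).re, sq_nonneg (φ a).im]
  by_contra hne
  have := key ((‖a‖^2 + 1) / (2 * (φ a).im))
  have e : (φ a).im * (2 * ((‖a‖^2 + 1) / (2 * (φ a).im))) = ‖a‖^2 + 1 := by field_simp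
  linarith

theorem state_pos (φ : A →L[ℂ] ℂ) (h : ‖φ‖ ≤ 1) (h1 : φ 1 = 1) (a : A) (ha : 0 ≤ a) : 0 ≤ φ a := by
  rw [Complex.nonneg_iff]
  refine ⟨?_, (state_sa φ h h1 a ha.isSelfAdjoint).symm⟩
  have hle : a ≤ algebraMap ℝ A ‖a‖ := IsSelfAdjoint.le_algebraMap_norm_self ha.isSelfAdjoint
  have h2 : 0 ≤ algebraMap ℝ A ‖a‖ - a := sub_nonneg.2 hle
  have h3 : ‖algebraMap ℝ A ‖a‖ - a‖ ≤ ‖a‖ :=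
    (CStarAlgebra.norm_le_iff_le_algebraMap _ (norm_nonneg a) h2).2 (sub_le_self _ ha)
  have h4 : ‖φ (algebraMap ℝ A ‖a‖ - a)‖ ≤ ‖a‖ :=
    (φ.le_opNorm _).trans ((mul_le_of_le_one_left (norm_nonneg _) h).trans h3)
  have h5 : φ (algebraMap ℝ A ‖a‖ - a) = ‖a‖ - φ a := by
    rw [map_sub, Algebra.algebraMap_eq_smul_one, ← Complex.coe_smul, map_smul, h1]; simp
  rw [h5] at h4
  have := (Complex.re_le_norm _).trans h4
  simp at this
  exact this

theorem ext_one {p : A} (hp : 0 ≤ p) (hp0 : p ≠ 0) (φ : A →L[ℂ] ℂ) (h : ‖φ‖ ≤ 1) (h1 : φ p = ‖p‖) :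
    φ 1 = 1 := by
  have : Nontrivial A := ⟨p, 0, hp0⟩
  have hn : 0 < ‖p‖ := norm_pos_iff.2 hp0
  have hsa : IsSelfAdjoint (p - algebraMap ℝ A (‖p‖/2)) :=
    hp.isSelfAdjoint.sub (IsSelfAdjoint.algebraMap A (by simp [IsSelfAdjoint]))
  have hb : ‖p - algebraMap ℝ A (‖p‖/2)‖ ≤ ‖p‖/2 := by
    have hspec : ∀ l ∈ spectrum ℝ (p - algebraMap ℝ A (‖p‖/2)), |l| ≤ ‖p‖/2 := by
      intro l hl
      have hl' : l + ‖p‖/2 ∈ spectrum ℝ p := by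
        have := (spectrum.add_mem_iff (R := ℝ) (a := p - algebraMap ℝ A (‖p‖/2)) (r := l + ‖p‖/2) (s := ‖p‖/2))
        have h3 := (spectrum.add_mem_add_iff (R := ℝ) (a := p - algebraMap ℝ A (‖p‖/2)) (r := l) (s := ‖p‖/2)).2 hl
        simpa using h3
      have l1 := spectrum_nonneg_of_nonneg hp hl'
      have l2 := (spectrum.norm_le_norm_of_mem hl')
      rw [Real.norm_of_nonneg l1] at l2
      rw [abs_le]; constructor <;> linarith
    rcases CStarAlgebra.norm_or_neg_norm_mem_spectrum hsa with h3 | h3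
    · have := hspec _ h3
      rwa [abs_of_nonneg (norm_nonneg _)] at this
    · have := hspec _ h3
      rwa [abs_neg, abs_of_nonneg (norm_nonneg _)] at this
  have h4 : ‖φ (p - algebraMap ℝ A (‖p‖/2))‖ ≤ ‖p‖/2 :=
    (φ.le_opNorm _).trans ((mul_le_of_le_one_left (norm_nonneg _) h).trans hb)
  have h5 : φ (p - algebraMap ℝ A (‖p‖/2)) = ((‖p‖/2 : ℝ) : ℂ) * (2 - φ 1) := by
    rw [map_sub, Algebra.algebraMap_eq_smul_one, ← Complex.coe_smul, map_smul, h1]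
    push_cast; simp; ring
  rw [h5, norm_mul, Complex.norm_real, Real.norm_of_nonneg (by positivity)] at h4
  have h6 : ‖2 - φ 1‖ ≤ 1 := by
    by_contra hc
    push Not at hc
    nlinarith
  have h7 : ‖φ 1‖ ≤ 1 := by
    have := φ.le_opNorm 1
    rw [norm_one, mul_one] at this
    exact this.trans h
  have r1 := (Complex.re_le_norm _).trans h6
  have r2 := (Complex.re_le_norm _).trans h7
  simp at r1
  have r3 : (φ 1).re = 1 := by linarith
  have h8 : (φ 1).re = ‖φ 1‖ := le_antisymm (Complex.re_le_norm _) (by rw [r3]; exact h7)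
  have h9 := (Complex.nonneg_iff.1 (Complex.re_eq_norm.1 h8)).2
  exact Complex.ext (by simpa using r3) (by simpa using h9.symm)

end states

end Part5

section Part6
open scoped InnerProductSpace ComplexOrder

section irr
universe u v
variable {A : Type u} [CStarAlgebra A] {H : Type v} [NormedAddCommGroup H] [InnerProductSpace ℂ H] [CompleteSpace H]

theorem irr_contr (π : A →⋆ₐ[ℂ] (H →L[ℂ] H)) (ξ : H) (hξ : ‖ξ‖ = 1)
    (hcyc : Dense (Set.range fun a => π a ξ)) {p : A} (hp : p ≠ 0) (φ : A →L[ℂ] ℂ)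
    (hφ : ∀ a, φ a = ⟪ξ, π a ξ⟫_ℂ) (hext : IsExt p φ) (T : H →L[ℂ] H) (hT : ∀ a, Commute T (π a))
    (hsa : IsSelfAdjoint T) (hn : ‖T‖ ≤ 1) : ∃ c : ℂ, ∀ v, T v = c • v := by
  set S := CFC.sqrt (1 - T^2) with hS
  have hSsa : IsSelfAdjoint S := (CFC.sqrt_nonneg _).isSelfAdjoint
  have hSc : ∀ a, Commute S (π a) := fun a => by
    have : Commute (1 - T^2) (π a) := ((Commute.one_left _)).sub_left ((hT a).pow_left 2)
    exact this.cfcₙ_nnreal _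
  have hU := hsa.self_add_I_smul_cfcSqrt_sub_sq_mem_unitary T hn
  rw [← hS] at hU
  set U := T + Complex.I • S with hUd
  have hUs : star U = T - Complex.I • S := by
    rw [hUd, star_add, star_smul, hsa.star_eq, hSsa.star_eq]; simp [sub_eq_add_neg]
  have hUc : ∀ a, Commute U (π a) := fun a => (hT a).add_left ((hSc a).smul_left _)
  have hUT : U + star U = (2 : ℂ) • T := by rw [hUs, hUd, two_smul]; abel
  have hUU : star U * U = 1 := Unitary.star_mul_self_of_mem hU
  let Q : ℂ → (H →L[ℂ] H) := fun e => (2⁻¹ : ℂ) • (1 + e • U)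
  have hQc : ∀ e a, Commute (Q e) (π a) := fun e a =>
    ((Commute.one_left _).add_left ((hUc a).smul_left _)).smul_left _
  have hQQ : ∀ e : ℂ, (starRingEnd ℂ) e = e → e * e = 1 → star (Q e) * Q e = (2⁻¹ : ℂ) • (1 + e • T) := by
    intro e he hee
    have : T = (2⁻¹ : ℂ) • (U + star U) := by rw [hUT, smul_smul]; norm_num
    have h2 : (starRingEnd ℂ) (2⁻¹ : ℂ) = 2⁻¹ := by
      rw [map_inv₀, Complex.conj_ofNat]
    have hst : star (Q e) = (2⁻¹ : ℂ) • (1 + e • star U) := by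
      simp only [Q, star_smul, star_add, star_one, Complex.star_def, he, h2]
    have hmul : star (Q e) * Q e = ((2⁻¹ : ℂ) * 2⁻¹) • (1 + e • U + e • star U + (e * e) • (star U * U)) := by
      rw [hst]
      simp only [Q, smul_mul_assoc, mul_smul_comm, add_mul, mul_add, one_mul, mul_one, smul_smul, smul_add]
      module
    rw [hmul, hee, hUU, this]
    module
  have inn : ∀ e : ℂ, ∀ a, ⟪Q e ξ, π a (Q e ξ)⟫_ℂ = ⟪ξ, (star (Q e) * Q e) (π a ξ)⟫_ℂ := by
    intro e a
    rw [ContinuousLinearMap.mul_apply, ContinuousLinearMap.star_eq_adjoint,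
      ContinuousLinearMap.adjoint_inner_right]
    congr 1
    have := congrArg (fun L : H →L[ℂ] H => L ξ) (hQc e a).eq
    simpa using this.symm
  let φf : ℂ → (A →L[ℂ] ℂ) := fun e => LinearMap.mkContinuous
    { toFun := fun a => ⟪Q e ξ, π a (Q e ξ)⟫_ℂ
      map_add' := fun a b => by simp [inner_add_right]
      map_smul' := fun c a => by simp [inner_smul_right] } (‖Q e ξ‖^2) (fun a => by
        refine (norm_inner_le_norm _ _).trans ?_
        have := pi_norm_le π a (Q e ξ)
        nlinarith [norm_nonneg (Q e ξ)])
  have hφf : ∀ e a, φf e a = ⟪Q e ξ, π a (Q e ξ)⟫_ℂ := fun e a => rfl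
  have hφb : ∀ e a, ‖φf e a‖ ≤ ‖Q e ξ‖^2 * ‖a‖ := fun e a => by
    rw [hφf]
    refine (norm_inner_le_norm _ _).trans ?_
    have := pi_norm_le π a (Q e ξ)
    nlinarith [norm_nonneg (Q e ξ)]
  have q1 := hQQ 1 (by simp) (by norm_num)
  have q2 := hQQ (-1) (by simp) (by norm_num)
  have hsum : ∀ a, φ a = φf 1 a + φf (-1) a := by
    intro a
    rw [hφf, hφf, inn, inn, ← inner_add_right, ← ContinuousLinearMap.add_apply, q1, q2, hφ]
    congr 1
    simp only [ContinuousLinearMap.add_apply, ContinuousLinearMap.smul_apply, ContinuousLinearMap.one_apply]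
    module
  have hs1 : ‖Q 1 ξ‖^2 + ‖Q (-1) ξ‖^2 = 1 := by
    have := hsum 1
    rw [hφ, hφf, hφf, map_one] at this
    simp only [ContinuousLinearMap.one_apply, inner_self_eq_norm_sq_to_K, hξ] at this
    have h3 := this.symm
    simp only [Complex.coe_algebraMap] at h3
    norm_cast at h3
    simpa using h3
  have hs := hext.split hp (φf 1) (φf (-1)) (‖Q 1 ξ‖^2) (by positivity)
    (by nlinarith [sq_nonneg ‖Q (-1) ξ‖]) (hφb 1) (fun a => by
      have := hφb (-1) a
      rwa [show (1 - ‖Q 1 ξ‖^2) = ‖Q (-1) ξ‖^2 by linarith]) hsum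
  set s := ‖Q 1 ξ‖^2 with hsd
  have h1 : ∀ a, ⟪ξ, (star (Q 1) * Q 1) (π a ξ)⟫_ℂ = ⟪ξ, (s : ℂ) • π a ξ⟫_ℂ := by
    intro a
    rw [← inn, ← hφf, hs, hφ, inner_smul_right]
  rw [q1] at h1
  have hTc : ∀ a v, T (π a v) = π a (T v) := fun a v => by
    have := congrArg (fun L : H →L[ℂ] H => L v) (hT a).eq
    simpa using this
  have h2 : ∀ a b, ⟪π b ξ, ((2⁻¹ : ℂ) • (1 + (1 : ℂ) • T) - (s : ℂ) • 1) (π a ξ)⟫_ℂ = 0 := by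
    intro a b
    have h3 := h1 (star b * a)
    rw [pi_inner]
    have : π (star b) (((2⁻¹ : ℂ) • (1 + (1 : ℂ) • T) - (s : ℂ) • 1) (π a ξ)) =
        ((2⁻¹ : ℂ) • (1 + (1 : ℂ) • T)) (π (star b * a) ξ) - (s : ℂ) • π (star b * a) ξ := by
      simp [hTc]
    rw [this, inner_sub_right, h3, sub_self]
  have h3 : ∀ v, ((2⁻¹ : ℂ) • (1 + (1 : ℂ) • T) - (s : ℂ) • (1 : H →L[ℂ] H)) v = 0 := by
    set L := ((2⁻¹ : ℂ) • (1 + (1 : ℂ) • T) - (s : ℂ) • (1 : H →L[ℂ] H)) with hL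
    have hzero : ∀ a, L (π a ξ) = 0 := by
      intro a
      have : (fun w => ⟪w, L (π a ξ)⟫_ℂ) = fun w => 0 := by
        apply Continuous.ext_on hcyc (by fun_prop) (by fun_prop)
        rintro _ ⟨b, rfl⟩
        exact h2 a b
      have := congrFun this (L (π a ξ))
      exact inner_self_eq_zero.1 this
    have : (fun w => L w) = fun w => 0 := by
      apply Continuous.ext_on hcyc (by fun_prop) (by fun_prop)
      rintro _ ⟨b, rfl⟩
      exact hzero b
    exact fun v => congrFun this v
  refine ⟨2 * s - 1, fun v => ?_⟩
  have h4 := h3 v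
  simp only [ContinuousLinearMap.add_apply, ContinuousLinearMap.sub_apply, ContinuousLinearMap.smul_apply, ContinuousLinearMap.one_apply, one_smul, smul_add] at h4
  have h5 : (2⁻¹ : ℂ) • T v = (s : ℂ) • v - (2⁻¹ : ℂ) • v := by
    rw [sub_eq_zero] at h4
    rw [← h4]; abel
  have h6 : T v = (2 : ℂ) • ((2⁻¹ : ℂ) • T v) := by rw [smul_smul]; norm_num
  rw [h6, h5, smul_sub, smul_smul, smul_smul, ← sub_smul]; norm_num

theorem irr_of_ext (π : A →⋆ₐ[ℂ] (H →L[ℂ] H)) (ξ : H) (hξ : ‖ξ‖ = 1)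
    (hcyc : Dense (Set.range fun a => π a ξ)) {p : A} (hp : p ≠ 0) (φ : A →L[ℂ] ℂ)
    (hφ : ∀ a, φ a = ⟪ξ, π a ξ⟫_ℂ) (hext : IsExt p φ) (T : H →L[ℂ] H)
    (hT : ∀ a v, T (π a v) = π a (T v)) : ∃ c : ℂ, ∀ v, T v = c • v := by
  have hsac : ∀ T : H →L[ℂ] H, (∀ a, Commute T (π a)) → IsSelfAdjoint T → ∃ c : ℂ, ∀ v, T v = c • v := by
    intro T hT hsa
    have hpos : 0 < ‖T‖ + 1 := by positivity
    have hk : star (((‖T‖ + 1)⁻¹ : ℝ) : ℂ) = (((‖T‖ + 1)⁻¹ : ℝ) : ℂ) := Complex.conj_ofReal _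
    obtain ⟨c, hc⟩ := irr_contr π ξ hξ hcyc hp φ hφ hext ((((‖T‖ + 1)⁻¹ : ℝ) : ℂ) • T)
      (fun a => (hT a).smul_left _) (by rw [IsSelfAdjoint, star_smul, hk, hsa.star_eq]) (by
        rw [norm_smul, Complex.norm_real, norm_inv, Real.norm_of_nonneg hpos.le, inv_mul_le_iff₀ hpos]; linarith)
    refine ⟨((‖T‖ + 1 : ℝ) : ℂ) * c, fun v => ?_⟩
    have hne : ((‖T‖ + 1 : ℝ) : ℂ) ≠ 0 := by exact_mod_cast hpos.ne'
    rw [mul_smul, ← hc v, ContinuousLinearMap.smul_apply, smul_smul, Complex.ofReal_inv, mul_inv_cancel₀ hne, one_smul]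
  have hTc : ∀ a, Commute T (π a) := fun a => by
    ext v; simp [hT]
  have hTs : ∀ a, Commute (star T) (π a) := fun a => by
    have := (hTc (star a)).star_star
    rwa [← map_star, star_star] at this
  obtain ⟨c1, h1⟩ := hsac (T + star T) (fun a => (hTc a).add_left (hTs a)) (IsSelfAdjoint.add_star_self T)
  obtain ⟨c2, h2⟩ := hsac (Complex.I • (T - star T)) (fun a => ((hTc a).sub_left (hTs a)).smul_left _) (by
    rw [IsSelfAdjoint, star_smul, star_sub, star_star, Complex.star_def, Complex.conj_I, neg_smul, ← smul_neg, neg_sub])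
  refine ⟨2⁻¹ * (c1 - Complex.I * c2), fun v => ?_⟩
  rw [mul_smul, sub_smul, mul_smul, ← h1, ← h2]
  simp only [ContinuousLinearMap.add_apply, ContinuousLinearMap.smul_apply, ContinuousLinearMap.sub_apply, smul_smul, Complex.I_mul_I]
  rw [neg_one_smul, sub_neg_eq_add]
  have : T v + star T v + (T v - star T v) = (2 : ℂ) • T v := by rw [two_smul]; abel
  rw [this, smul_smul]; norm_num

end irr

section gns
universe u
variable {A : Type u} [CStarAlgebra A]
attribute [local instance] CStarAlgebra.spectralOrder CStarAlgebra.spectralOrderedRing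

theorem exists_irr {p : A} (hp : 0 ≤ p) (hp0 : p ≠ 0) :
    ∃ (ρ : Irr A) (x : ρ.H), ‖x‖ = 1 ∧ ⟪x, ρ.π p x⟫_ℂ = ‖p‖ := by
  obtain ⟨φ, hφ⟩ := exists_ext p
  have h1 := ext_one hp hp0 φ hφ.1.1 hφ.1.2
  let f : A →ₚ[ℂ] ℂ := PositiveLinearMap.mk₀ (φ : A →ₗ[ℂ] ℂ) (fun a ha => state_pos φ hφ.1.1 h1 a ha)
  have hf : ∀ a, f a = φ a := fun a => rfl
  let x : f.GNS := ((f.toPreGNS 1 : f.PreGNS) : f.GNS)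
  have hx : ∀ a, f.gnsStarAlgHom a x = ((f.toPreGNS a : f.PreGNS) : f.GNS) := by
    intro a
    have := f.gnsNonUnitalStarAlgHom_apply_coe (a := a) (b := f.toPreGNS 1)
    refine this.trans ?_
    simp
  have hin : ∀ a, φ a = ⟪x, f.gnsStarAlgHom a x⟫_ℂ := by
    intro a
    rw [hx]
    simp only [x]
    rw [UniformSpace.Completion.inner_coe, PositiveLinearMap.preGNS_inner_def]
    simp [hf]
  have hn : ‖x‖ = 1 := by
    have := hin 1
    rw [h1, map_one, ContinuousLinearMap.one_apply, inner_self_eq_norm_sq_to_K] at this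
    have h3 : ‖x‖^2 = 1 := by
      simp only [Complex.coe_algebraMap] at this
      exact_mod_cast this.symm
    nlinarith [norm_nonneg x]
  have hd : Dense (Set.range fun a => f.gnsStarAlgHom a x) := by
    have := UniformSpace.Completion.denseRange_coe (α := f.PreGNS)
    refine this.mono ?_
    rintro _ ⟨v, rfl⟩
    exact ⟨f.ofPreGNS v, hx _⟩
  refine ⟨⟨f.GNS, f.gnsStarAlgHom, irr_of_ext f.gnsStarAlgHom x hn hd hp0 φ hin hφ⟩, x, hn, ?_⟩
  rw [← hφ.1.2]
  exact (hin p).symm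

theorem norm_bound (k : A) (hk : IsSelfAdjoint k) (m : ℝ)
    (h : ∀ (ρ : Irr A) (x : ρ.H), ‖x‖ = 1 → (⟪x, ρ.π k x⟫_ℂ).re ≤ m) (r : ℝ) (hr : ‖k‖ + 1 ≤ r) [Nontrivial A] :
    ‖k + (r : ℂ) • (1 : A)‖ ≤ m + r := by
  have e : (r : ℂ) • (1 : A) = algebraMap ℝ A r := by
    rw [Algebra.algebraMap_eq_smul_one, Complex.coe_smul]
  have h0 : 0 ≤ k + algebraMap ℝ A r := by
    have h1 := hk.neg_algebraMap_norm_le_self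
    have h2 : algebraMap ℝ A ‖k‖ ≤ algebraMap ℝ A r := algebraMap_mono A (by linarith)
    have h3 : 0 ≤ k + algebraMap ℝ A ‖k‖ := by rw [← neg_le_iff_add_nonneg]; exact h1
    exact h3.trans (by gcongr)
  have hne : k + algebraMap ℝ A r ≠ 0 := by
    intro h2
    have : k = -algebraMap ℝ A r := eq_neg_of_add_eq_zero_left h2
    have h3 := congrArg norm this
    rw [norm_neg, norm_algebraMap', Real.norm_of_nonneg (by linarith [norm_nonneg k])] at h3
    linarith
  rw [e]
  obtain ⟨ρ, x, hx, hp⟩ := exists_irr h0 hne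
  have h1 := h ρ x hx
  have h2 := congrArg Complex.re hp
  rw [← e, map_add, map_smul, map_one, ContinuousLinearMap.add_apply, inner_add_right] at h2
  simp only [ContinuousLinearMap.smul_apply, ContinuousLinearMap.one_apply, inner_smul_right, inner_self_eq_norm_sq_to_K, hx] at h2
  rw [e] at h2
  simp at h2
  rw [← h2]
  linarith

end gns

end Part6

section Part7
open scoped InnerProductSpace ComplexOrder

section rd
universe u
attribute [local instance] CStarAlgebra.spectralOrder CStarAlgebra.spectralOrderedRing
variable {A : Type u} [CStarAlgebra A]

theorem two_unitaries (y : A) (hy : IsUnit y) (hn : ‖y‖ ≤ 1) :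
    ∃ v ∈ unitary A, ∃ w ∈ unitary A, y + y = v + w := by
  set h := CFC.sqrt (star y * y) with hh
  have hpos : 0 ≤ star y * y := star_mul_self_nonneg y
  have hsa : IsSelfAdjoint h := (CFC.sqrt_nonneg _).isSelfAdjoint
  have hsq : h * h = star y * y := CFC.sqrt_mul_sqrt_self _ hpos
  have hu : IsUnit (h * h) := by rw [hsq]; exact hy.star.mul hy
  have hhu : IsUnit h := ((Commute.refl h).isUnit_mul_iff.mp hu).1
  obtain ⟨k, hk⟩ := hhu
  have hnorm : ‖h‖ ≤ 1 := by
    have h1 : ‖h * h‖ = ‖h‖ * ‖h‖ := by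
      have := CStarRing.norm_star_mul_self (x := h)
      rwa [hsa.star_eq] at this
    have h2 : ‖star y * y‖ = ‖y‖ * ‖y‖ := CStarRing.norm_star_mul_self
    rw [hsq, h2] at h1
    nlinarith [norm_nonneg y, norm_nonneg h]
  have hksa : star ((k⁻¹ : Aˣ) : A) = ((k⁻¹ : Aˣ) : A) := by
    have h1 : star k = k := Units.ext (by rw [Units.coe_star, hk, hsa.star_eq])
    rw [← Units.coe_star, star_inv, h1]
  set w0 := y * ((k⁻¹ : Aˣ) : A) with hw0
  have hw0h : w0 * h = y := by rw [hw0, mul_assoc, ← hk]; simp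
  have e1 : star w0 * w0 = 1 := by
    rw [hw0, star_mul, hksa]
    calc ((k⁻¹ : Aˣ) : A) * star y * (y * ((k⁻¹ : Aˣ) : A)) = ((k⁻¹ : Aˣ) : A) * (star y * y) * ((k⁻¹ : Aˣ) : A) := by noncomm_ring
      _ = 1 := by rw [← hsq, ← hk]; simp
  have hw0u : IsUnit w0 := hy.mul (k⁻¹).isUnit
  have e2 : w0 * star w0 = 1 := by
    obtain ⟨q, hq⟩ := hw0u
    rw [← hq] at e1 ⊢
    have : star (q : A) = ((q⁻¹ : Aˣ) : A) := by
      exact (Units.inv_eq_of_mul_eq_one_left e1).symm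
    rw [this]; simp
  have hw0m : w0 ∈ unitary A := Unitary.mem_iff.mpr ⟨e1, e2⟩
  have hU := hsa.self_add_I_smul_cfcSqrt_sub_sq_mem_unitary h hnorm
  set S := CFC.sqrt (1 - h^2) with hS
  have hSsa : IsSelfAdjoint S := (CFC.sqrt_nonneg _).isSelfAdjoint
  refine ⟨w0 * (h + Complex.I • S), mul_mem hw0m hU, w0 * star (h + Complex.I • S), mul_mem hw0m (Unitary.star_mem hU), ?_⟩
  rw [← mul_add, star_add, star_smul, hsa.star_eq, hSsa.star_eq]
  have : h + Complex.I • S + (h + star Complex.I • S) = h + h := by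
    simp; abel
  rw [this, mul_add, hw0h]

theorem gardner (x u : A) (hx : ‖x‖ < 1) (hu : u ∈ unitary A) :
    ∃ v ∈ unitary A, ∃ w ∈ unitary A, x + u = v + w := by
  have e := Unitary.mem_iff.mp hu
  set y : A := (1/2 : ℂ) • (star u * x + 1) with hy
  have hn0 : ‖star u * x‖ < 1 := by
    rw [CStarRing.norm_mem_unitary_mul _ (Unitary.star_mem hu)]; exact hx
  have hyu : IsUnit y := by
    have h1 : IsUnit (1 - (-(star u * x))) := isUnit_one_sub_of_norm_lt_one (by rwa [norm_neg])
    have h2 : IsUnit (star u * x + 1) := by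
      convert h1 using 1; abel
    have := h2.smul (Units.mk0 (1/2 : ℂ) (by norm_num))
    exact this
  have hone : ‖(1:A)‖ ≤ 1 := by
    nontriviality A
    simp
  have hyn : ‖y‖ ≤ 1 := by
    rw [hy, norm_smul]
    have := norm_add_le (star u * x) 1
    norm_num
    linarith
  obtain ⟨v, hv, w, hw, h⟩ := two_unitaries y hyu hyn
  refine ⟨u * v, mul_mem hu hv, u * w, mul_mem hu hw, ?_⟩
  rw [← mul_add, ← h, hy, ← two_smul ℂ, smul_smul]
  norm_num
  rw [mul_add, ← mul_assoc, e.2]; simp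

theorem gardner_iter (x : A) (hx : ‖x‖ < 1) (T : A →L[ℂ] A) (C : ℝ)
    (hT : ∀ u ∈ unitary A, ‖T u‖ ≤ C) (n : ℕ) :
    ∃ u ∈ unitary A, ∃ s : A, (n : ℂ) • x + 1 = s + u ∧ ‖T s‖ ≤ n * C := by
  induction n with
  | zero => exact ⟨1, one_mem _, 0, by simp, by simp⟩
  | succ n ih =>
    obtain ⟨u, hu, s, hs, hc⟩ := ih
    obtain ⟨v, hv, w, hw, h⟩ := gardner x u hx hu
    refine ⟨w, hw, s + v, ?_, ?_⟩
    · push_cast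
      rw [add_smul, one_smul, add_right_comm, hs, add_assoc, add_comm u x, h]; abel
    · rw [map_add]
      refine (norm_add_le _ _).trans ?_
      have := hT v hv
      push_cast; linarith

theorem russo_dye (T : A →L[ℂ] A) (C : ℝ)
    (hT : ∀ u ∈ unitary A, ‖T u‖ ≤ C) : ‖T‖ ≤ C := by
  have hC : 0 ≤ C := (norm_nonneg _).trans (hT 1 (one_mem _))
  have key : ∀ x : A, ‖x‖ < 1 → ‖T x‖ ≤ C := by
    intro x hx
    have h : ∀ n : ℕ, n * ‖T x‖ ≤ n * C + 2 * C := by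
      intro n
      obtain ⟨u, hu, s, hs, hc⟩ := gardner_iter x hx T C hT n
      have : (n : ℂ) • T x = T s + T u - T 1 := by
        rw [← map_add, ← hs]; simp
      have h2 : ‖(n : ℂ) • T x‖ = n * ‖T x‖ := by rw [norm_smul]; simp
      rw [← h2, this]
      have a1 := norm_sub_le (T s + T u) (T 1)
      have a2 := norm_add_le (T s) (T u)
      have a3 := hT u hu
      have a4 := hT 1 (one_mem _)
      linarith
    by_contra hcon
    push Not at hcon
    obtain ⟨n, hn⟩ := exists_nat_gt (2 * C / (‖T x‖ - C))
    rw [div_lt_iff₀ (by linarith)] at hn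
    linarith [h n]
  have hcl : IsClosed {x : A | ‖T x‖ ≤ C} := isClosed_le (by fun_prop) continuous_const
  have hsub : Metric.closedBall (0:A) 1 ⊆ {x : A | ‖T x‖ ≤ C} := by
    rw [← closure_ball (0:A) one_ne_zero]
    exact closure_minimal (fun x hx => key x (by simpa using hx)) hcl
  exact ContinuousLinearMap.opNorm_le_of_unit_norm hC (fun x hx => hsub (by simp [hx]))
end rd

end Part7

section Part8
open scoped InnerProductSpace ComplexOrder
section asm1
universe u

theorem numRange_mk {B : Type*} [NormedRing B] [NormedAlgebra ℂ B] [NormOneClass B] (a : B)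
    (f : B →L[ℂ] ℂ) (h : ‖f‖ ≤ 1) (h1 : f 1 = 1) : f a ∈ numRange B a := by
  refine ⟨f, le_antisymm h ?_, h1, rfl⟩
  have := f.le_opNorm 1
  rw [h1] at this
  simpa using this

theorem numRange_closed {B : Type*} [NormedRing B] [NormedAlgebra ℂ B] [NormOneClass B] (a : B) :
    IsClosed (numRange B a) := by
  have hK := ContinuousLinearMap.isCompact_image_coe_closedBall (σ₁₂ := RingHom.id ℂ) (0 : B →L[ℂ] ℂ) 1
  have hK' := hK.inter_right (isClosed_eq (continuous_apply (1 : B)) (continuous_const (y := (1:ℂ))))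
  have h3 := hK'.image (continuous_apply a)
  convert h3.isClosed using 1
  ext z
  constructor
  · rintro ⟨f, hf, h1, rfl⟩
    exact ⟨f, ⟨⟨f, by simp [hf], rfl⟩, h1⟩, rfl⟩
  · rintro ⟨g, ⟨⟨f, hf, rfl⟩, h1⟩, rfl⟩
    exact numRange_mk a f (by simpa using hf) h1

variable {A : Type u} [CStarAlgebra A] [Nontrivial A]

theorem sup_incl (a b : A) (M : A →L[ℂ] A) (hM : ∀ x, M x = a * x * b) :
    closure (⋃ u : unitary A, numRange A ((u : A) * a * star (u : A) * b)) ⊆ numRange (A →L[ℂ] A) M := by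
  refine closure_minimal (Set.iUnion_subset fun u => ?_) (numRange_closed M)
  rintro z ⟨f, hf, h1, rfl⟩
  let Φ : (A →L[ℂ] A) →ₗ[ℂ] ℂ :=
    { toFun := fun T => f ((u : A) * T (star (u : A)))
      map_add' := fun S T => by simp [mul_add]
      map_smul' := fun c T => by simp }
  have hΦ : ∀ T, ‖Φ T‖ ≤ 1 * ‖T‖ := fun T => by
    calc ‖f ((u : A) * T (star (u : A)))‖ ≤ ‖f‖ * ‖(u : A) * T (star (u : A))‖ := f.le_opNorm _
      _ = ‖T (star (u : A))‖ := by rw [hf, one_mul, CStarRing.norm_mem_unitary_mul _ u.2]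
      _ ≤ ‖T‖ * ‖star (u : A)‖ := T.le_opNorm _
      _ = 1 * ‖T‖ := by rw [norm_star, CStarRing.norm_of_mem_unitary u.2]; ring
  have := numRange_mk M (Φ.mkContinuous 1 hΦ) (LinearMap.mkContinuous_norm_le _ zero_le_one _) (by
    show f ((u : A) * (star (u : A))) = 1
    rw [(Unitary.mem_iff.mp u.2).2, h1])
  convert this using 1
  show _ = f _
  rw [hM]; simp only [mul_assoc]

def QSet (a b : A) : Set ℂ := ⋃ ρ : Irr A, TSet (ρ.π (star a)) (ρ.π b)

theorem mem_QSet (a b : A) (ρ : Irr A) (x : ρ.H) (hx : ‖x‖ = 1) (u : A) (hu : u ∈ unitary A) :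
    ⟪x, ρ.π (u * a * star u * b) x⟫_ℂ ∈ QSet a b := by
  refine Set.mem_iUnion.mpr ⟨ρ, x, ρ.π (star u) x, ρ.π (star u) (ρ.π b x), hx, ?_, ?_, ?_, ?_⟩
  · rw [pi_unitary_norm _ (Unitary.star_mem hu), hx]
  · rw [pi_unitary_norm _ (Unitary.star_mem hu)]
  · rw [pi_unitary_inner _ (Unitary.star_mem hu)]
  · rw [pi_inner, pi_inner]
    simp [map_mul]

/- growth estimate -/
theorem norm_growth (c : A) (m : ℝ) (K : ℝ) (hc : ‖c‖ ≤ K)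
    (h : ∀ (ρ : Irr A) (x : ρ.H), ‖x‖ = 1 → (⟪x, ρ.π c x⟫_ℂ).re ≤ m) (t : ℝ) (ht : 0 < t)
    (htK : 2 * t * (K + 1) ≤ 1) : ‖1 + (t : ℂ) • c‖ ^ 2 ≤ 1 + 2 * t * m + t^2 * K^2 := by
  set k : A := (1/2 : ℂ) • (c + star c) with hk
  have hsa : IsSelfAdjoint k := by
    rw [isSelfAdjoint_iff, hk, star_smul, star_add, star_star, add_comm]
    simp
  have hK : 0 ≤ K := (norm_nonneg _).trans hc
  have hkn : ‖k‖ ≤ K := by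
    rw [hk, norm_smul]
    have := norm_add_le c (star c)
    rw [norm_star] at this
    norm_num; linarith
  have hre : ∀ (ρ : Irr A) (x : ρ.H), ‖x‖ = 1 → (⟪x, ρ.π k x⟫_ℂ).re ≤ m := by
    intro ρ x hx
    have h1 := h ρ x hx
    have h2 : ⟪x, ρ.π (star c) x⟫_ℂ = star ⟪x, ρ.π c x⟫_ℂ := by
      rw [← pi_inner]; exact (inner_conj_symm _ _).symm
    rw [hk]
    simp only [map_smul, map_add, ContinuousLinearMap.smul_apply, ContinuousLinearMap.add_apply, inner_smul_right, inner_add_right, h2]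
    have : ∀ z : ℂ, (1/2 : ℂ) * (z + star z) = (z.re : ℂ) := by
      intro z
      apply Complex.ext <;> simp; ring
    rw [this]; simpa using h1
  have hb := norm_bound k hsa m hre (1 / (2 * t)) (by
    rw [le_div_iff₀ (by positivity)]
    nlinarith)
  have hb2 : ‖1 + ((2 * t : ℝ) : ℂ) • k‖ ≤ 1 + 2 * t * m := by
    have e : 1 + ((2 * t : ℝ) : ℂ) • k = ((2 * t : ℝ) : ℂ) • (k + ((1 / (2 * t) : ℝ) : ℂ) • (1 : A)) := by
      rw [smul_add, smul_smul _ _ (1:A), ← Complex.ofReal_mul, mul_one_div_cancel (by positivity)]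
      simp [add_comm]
    rw [e, norm_smul, Complex.norm_real, Real.norm_of_nonneg (by positivity)]
    calc 2 * t * _ ≤ 2 * t * (m + 1 / (2 * t)) := by gcongr
      _ = _ := by field_simp; ring
  have e2 : ‖1 + (t : ℂ) • c‖ ^ 2 = ‖star (1 + (t : ℂ) • c) * (1 + (t : ℂ) • c)‖ := by
    rw [CStarRing.norm_star_mul_self, sq]
  have e3 : star (1 + (t : ℂ) • c) * (1 + (t : ℂ) • c) = (1 + ((2 * t : ℝ) : ℂ) • k) + ((t : ℂ)^2) • (star c * c) := by
    rw [hk, star_add, star_smul, star_one, smul_smul]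
    have : star (t : ℂ) = t := Complex.conj_ofReal t
    have h4 : (((2 * t : ℝ) : ℂ) * (1/2)) = t := by push_cast; ring
    rw [this, h4]
    simp only [mul_add, add_mul, one_mul, mul_one, smul_mul_smul_comm, smul_add, sq]
    abel
  rw [e2, e3]
  refine (norm_add_le _ _).trans ?_
  rw [norm_smul, CStarRing.norm_star_mul_self, norm_pow, Complex.norm_real, Real.norm_of_nonneg ht.le]
  have : t^2 * (‖c‖ * ‖c‖) ≤ t^2 * K^2 := by
    rw [sq K]; gcongr
  linarith

theorem sub_incl (a b : A) (M : A →L[ℂ] A) (hM : ∀ x, M x = a * x * b) :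
    numRange (A →L[ℂ] A) M ⊆ closure (convexHull ℝ (QSet a b)) := by
  rintro z ⟨Φ, hΦ, hΦ1, rfl⟩
  by_contra hz
  obtain ⟨f, m, hf1, hf2⟩ := geometric_hahn_banach_closed_point ((convex_convexHull ℝ (QSet a b)).closure) isClosed_closure hz
  -- real functional as Re (θ w)
  set θ : ℂ := ⟨f 1, - f Complex.I⟩ with hθ
  have hfθ : ∀ w : ℂ, f w = (θ * w).re := by
    intro w
    have : w = w.re • (1:ℂ) + w.im • Complex.I := by
      apply Complex.ext <;> simp
    conv_lhs => rw [this]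
    rw [map_add, map_smul, map_smul]
    simp [hθ]; ring
  set K : ℝ := ‖θ‖ * (‖a‖ * ‖b‖) with hK
  have hK0 : 0 ≤ K := by positivity
  have main : ∀ t : ℝ, 0 < t → 2 * t * (K + 1) ≤ 1 →
      ‖(1 : A →L[ℂ] A) + ((t:ℂ) * θ) • M‖ ^ 2 ≤ 1 + 2 * t * m + t^2 * K^2 := by
    intro t ht htK
    have hu : ∀ u ∈ unitary A, ‖((1 : A →L[ℂ] A) + ((t:ℂ) * θ) • M) u‖ ^ 2 ≤ 1 + 2 * t * m + t^2 * K^2 := by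
      intro u hu
      set c := θ • (star u * a * u * b) with hc
      have hsu := Unitary.star_mem hu
      have e1 : ((1 : A →L[ℂ] A) + ((t:ℂ) * θ) • M) u = u * (1 + (t : ℂ) • c) := by
        simp only [ContinuousLinearMap.add_apply, ContinuousLinearMap.one_apply, ContinuousLinearMap.smul_apply, hM, mul_add, hc, smul_smul, mul_smul_comm, mul_one]
        rw [mul_assoc (star u * a), mul_assoc (star u), ← mul_assoc u, (Unitary.mem_iff.mp hu).2, one_mul, mul_assoc]
      rw [e1, CStarRing.norm_mem_unitary_mul _ hu]
      refine norm_growth c m K ?_ ?_ t ht htK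
      · rw [hc, norm_smul, hK]
        gcongr
        refine (norm_mul_le _ _).trans ?_
        rw [CStarRing.norm_mul_mem_unitary _ hu, CStarRing.norm_mem_unitary_mul _ hsu]
      · intro ρ x hx
        have := mem_QSet a b ρ x hx (star u) hsu
        rw [star_star] at this
        have h2 := hf1 _ (subset_closure (subset_convexHull ℝ _ this))
        rw [hfθ] at h2
        rw [hc, map_smul, ContinuousLinearMap.smul_apply, inner_smul_right]
        exact h2.le
    have h := russo_dye _ _ (fun u h => Real.le_sqrt_of_sq_le (hu u h))
    have hnn : 0 ≤ 1 + 2 * t * m + t^2 * K^2 := (sq_nonneg _).trans (hu 1 (one_mem _))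
    calc _ ≤ (Real.sqrt (1 + 2 * t * m + t^2 * K^2))^2 := by gcongr
      _ = _ := Real.sq_sqrt hnn
  rw [hfθ] at hf2
  set s := (θ * Φ M).re with hs
  have low : ∀ t : ℝ, 0 < t → 1 + t * s ≤ ‖(1 : A →L[ℂ] A) + ((t:ℂ) * θ) • M‖ := by
    intro t ht
    have h1 := Φ.le_opNorm ((1 : A →L[ℂ] A) + ((t:ℂ) * θ) • M)
    rw [hΦ, one_mul] at h1
    have h2 := Complex.re_le_norm (Φ ((1 : A →L[ℂ] A) + ((t:ℂ) * θ) • M))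
    rw [map_add, map_smul, hΦ1] at h2
    have h3 : (1 + ((t:ℂ) * θ) • Φ M).re = 1 + t * s := by
      rw [smul_eq_mul, mul_assoc, Complex.add_re, Complex.re_ofReal_mul]; simp [hs]
    rw [h3] at h2
    rw [map_add, map_smul, hΦ1] at h1
    linarith
  -- choose t
  set t : ℝ := min (1 / (2 * (K + 1) )) (min (1 / (|s| + 1)) ((s - m) / (K^2 + 1))) with ht
  have htp : 0 < t := by
    rw [ht]; refine lt_min (by positivity) (lt_min (by positivity) (div_pos (by linarith) (by positivity)))
  have t1 : t ≤ 1 / (2 * (K + 1)) := min_le_left _ _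
  have t2 : t ≤ 1 / (|s| + 1) := (min_le_right _ _).trans (min_le_left _ _)
  have t3 : t ≤ (s - m) / (K^2 + 1) := (min_le_right _ _).trans (min_le_right _ _)
  rw [le_div_iff₀ (by positivity)] at t1 t2 t3
  have hm := main t htp (by linarith)
  have hl := low t htp
  have hpos : 0 ≤ 1 + t * s := by nlinarith [neg_abs_le s]
  have : (1 + t * s)^2 ≤ 1 + 2 * t * m + t^2 * K^2 := (by gcongr : (1 + t * s)^2 ≤ _).trans hm
  have h5 : t * (t * (K^2+1)) ≤ t * (s - m) := by gcongr
  nlinarith [sq_nonneg (t * s), mul_pos htp htp, mul_pos htp (sub_pos.mpr hf2)]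
end asm1

end Part8

section Part9
open scoped InnerProductSpace ComplexOrder
section asm2
universe u
variable {A : Type u} [CStarAlgebra A]

def IrrEq (ρ σ : Irr A) : Prop :=
  ∃ W : ρ.H ≃ₗᵢ[ℂ] σ.H, ∀ a v, W (ρ.π a v) = σ.π a (W v)

theorem IrrEq.equiv : Equivalence (IrrEq (A := A)) where
  refl ρ := ⟨LinearIsometryEquiv.refl ℂ ρ.H, fun a v => rfl⟩
  symm := by
    rintro ρ σ ⟨W, hW⟩
    refine ⟨W.symm, fun a v => ?_⟩
    apply W.injective
    rw [hW]; simp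
  trans := by
    rintro ρ σ τ ⟨W, hW⟩ ⟨V, hV⟩
    exact ⟨W.trans V, fun a v => by simp [hW, hV]⟩

theorem IrrEq.tset {ρ σ : Irr A} (h : IrrEq ρ σ) (c b : A) :
    TSet (ρ.π c) (ρ.π b) ⊆ TSet (σ.π c) (σ.π b) := by
  obtain ⟨W, hW⟩ := h
  rintro z ⟨x, ξ, η, h1, h2, h3, h4, rfl⟩
  refine ⟨W x, W ξ, W η, by simpa using h1, by simpa using h2, ?_, ?_, ?_⟩
  · rw [← hW, W.norm_map, W.norm_map, h3]
  · rw [← hW, W.inner_map_map, W.inner_map_map, h4]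
  · rw [← hW, W.inner_map_map]

theorem irr_disj {ρ σ : Irr A} (h : ¬ IrrEq ρ σ) (S : ρ.H →L[ℂ] σ.H)
    (hS : ∀ a v, S (ρ.π a v) = σ.π a (S v)) : S = 0 := by
  by_contra hne
  apply h
  have hS' : ∀ a w, S.adjoint (σ.π a w) = ρ.π a (S.adjoint w) := by
    intro a w
    refine ext_inner_left ℂ fun v => ?_
    rw [ContinuousLinearMap.adjoint_inner_right]
    have := pi_inner ρ.π (star a) v (S.adjoint w)
    rw [star_star] at this
    rw [← this, ContinuousLinearMap.adjoint_inner_right, hS, pi_inner, star_star]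
  obtain ⟨c, hc⟩ := ρ.irr (S.adjoint ∘L S) (fun a v => by simp [hS, hS'])
  obtain ⟨d, hd⟩ := σ.irr (S ∘L S.adjoint) (fun a v => by simp [hS, hS'])
  simp only [ContinuousLinearMap.comp_apply] at hc hd
  obtain ⟨v0, hv0⟩ : ∃ v, S v ≠ 0 := by
    by_contra hcon
    push Not at hcon
    exact hne (ContinuousLinearMap.ext hcon)
  have hin : ∀ v w, ⟪S v, S w⟫_ℂ = c * ⟪v, w⟫_ℂ := by
    intro v w
    rw [← ContinuousLinearMap.adjoint_inner_right, hc, inner_smul_right]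
  have hv00 : v0 ≠ 0 := by rintro rfl; simp at hv0
  -- c is a positive real
  set r : ℝ := ‖S v0‖ ^ 2 / ‖v0‖ ^ 2 with hr
  have hrp : 0 < r := by
    have := norm_pos_iff.mpr hv0
    have := norm_pos_iff.mpr hv00
    positivity
  have hcr : c = r := by
    have := hin v0 v0
    rw [inner_self_eq_norm_sq_to_K, inner_self_eq_norm_sq_to_K] at this
    have h0 : ((‖v0‖ : ℂ))^2 ≠ 0 := by
      simpa using hv00
    have h2 : c = (‖S v0‖ : ℂ)^2 / (‖v0‖:ℂ)^2 := by
      rw [eq_div_iff h0]; exact this.symm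
    rw [h2, hr]; push_cast; rfl
  have hdc : d = c := by
    have h1 := hd (S v0)
    rw [hc, map_smul] at h1
    exact (smul_left_injective ℂ hv0 h1).symm
  have hn : ∀ v, ‖S v‖ = Real.sqrt r * ‖v‖ := by
    intro v
    have := hin v v
    rw [inner_self_eq_norm_sq_to_K, inner_self_eq_norm_sq_to_K, hcr] at this
    have h1 : (‖S v‖ : ℂ)^2 = (r : ℂ) * (‖v‖ : ℂ)^2 := this
    have h2 : ‖S v‖^2 = r * ‖v‖^2 := by exact_mod_cast h1
    rw [← Real.sqrt_sq (norm_nonneg (S v)), h2, Real.sqrt_mul hrp.le, Real.sqrt_sq (norm_nonneg _)]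
  have hsq : (0:ℝ) < Real.sqrt r := Real.sqrt_pos.mpr hrp
  have hsqc : ((Real.sqrt r : ℝ) : ℂ) ≠ 0 := by exact_mod_cast hsq.ne'
  let W0 : ρ.H →ₗᵢ[ℂ] σ.H :=
    { toLinearMap := (((Real.sqrt r : ℝ) : ℂ)⁻¹ • S : ρ.H →L[ℂ] σ.H)
      norm_map' := fun v => by
        show ‖((Real.sqrt r : ℝ) : ℂ)⁻¹ • S v‖ = _
        rw [norm_smul, norm_inv, Complex.norm_real, Real.norm_of_nonneg hsq.le, hn]
        field_simp }
  have hW0 : ∀ v, W0 v = ((Real.sqrt r : ℝ) : ℂ)⁻¹ • S v := fun v => rfl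
  have hsurj : Function.Surjective W0 := by
    intro w
    refine ⟨((Real.sqrt r : ℝ) : ℂ) • c⁻¹ • S.adjoint w, ?_⟩
    have hc0 : c ≠ 0 := by rw [hcr]; exact_mod_cast hrp.ne'
    rw [hW0, map_smul, map_smul, hd, hdc, smul_smul, smul_smul, smul_smul, inv_mul_cancel₀ hsqc, one_mul, inv_mul_cancel₀ hc0, one_smul]
  refine ⟨LinearIsometryEquiv.ofSurjective W0 hsurj, fun a v => ?_⟩
  show W0 _ = σ.π a (W0 v)
  rw [hW0, hW0, hS, map_smul]

variable [Nontrivial A]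

theorem hull_sub (a b : A) : convexHull ℝ (QSet a b) ⊆
    closure (⋃ u : unitary A, numRange A ((u : A) * a * star (u : A) * b)) := by
  classical
  intro z hz
  obtain ⟨ι, _, w, zz, hw0, hw1, hzz, rfl⟩ := mem_convexHull_iff_exists_fintype.mp hz
  have hzz' : ∀ i, ∃ ρ : Irr A, zz i ∈ TSet (ρ.π (star a)) (ρ.π b) := fun i => Set.mem_iUnion.mp (hzz i)
  choose ρ0 hρ0 using hzz'
  let st : Setoid (Irr A) := ⟨IrrEq, IrrEq.equiv⟩
  let q0 : ι → Quotient st := fun i => Quotient.mk st (ρ0 i)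
  let κ := Set.range q0
  let q : ι → κ := fun i => ⟨q0 i, i, rfl⟩
  letI : Fintype κ := Fintype.ofFinite κ
  let σ : κ → Irr A := fun k => Quotient.out k.1
  have hσ : ∀ i, zz i ∈ TSet ((σ (q i)).π (star a)) ((σ (q i)).π b) := by
    intro i
    have h1 : IrrEq (σ (q i)) (ρ0 i) := Quotient.mk_out (s := st) (ρ0 i)
    exact (IrrEq.equiv.symm h1).tset _ _ (hρ0 i)
  have hdis : ∀ k l, k ≠ l → ¬ IrrEq (σ k) (σ l) := by
    intro k l hkl h
    apply hkl
    have : Quotient.mk st (σ k) = Quotient.mk st (σ l) := Quotient.sound h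
    rw [Quotient.out_eq, Quotient.out_eq] at this
    exact Subtype.ext this
  let t : κ → ℝ := fun k => ∑ i with q i = k, w i
  have ht0 : ∀ k, 0 ≤ t k := fun k => Finset.sum_nonneg fun i _ => hw0 i
  have ht1 : ∑ k, t k = 1 := by rw [← hw1]; exact Finset.sum_fiberwise _ _ _
  have hy : ∀ k, ∃ y ∈ TSet ((σ k).π (star a)) ((σ k).π b), t k • y = ∑ i with q i = k, w i • zz i := by
    intro k
    have hmem : ∀ i ∈ Finset.univ.filter (fun i => q i = k), zz i ∈ TSet ((σ k).π (star a)) ((σ k).π b) := by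
      intro i hi
      have : q i = k := by simpa using hi
      rw [← this]; exact hσ i
    rcases (ht0 k).eq_or_lt with h | h
    · obtain ⟨_, i, hi⟩ := k
      refine ⟨zz i, hmem i (by simp [q, hi]), ?_⟩
      rw [← h, zero_smul]
      symm
      refine Finset.sum_eq_zero fun j hj => ?_
      rw [(Finset.sum_eq_zero_iff_of_nonneg (fun i _ => hw0 i)).mp h.symm j hj, zero_smul]
    · refine ⟨_, (TSet_convex _ _).centerMass_mem (fun i _ => hw0 i) h hmem, ?_⟩
      rw [Finset.centerMass, smul_inv_smul₀ h.ne']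
  choose y hyT hyS using hy
  have hsum : ∑ i, w i • zz i = ∑ k, t k • y k := by
    simp only [hyS]; exact (Finset.sum_fiberwise _ _ _).symm
  rw [hsum]
  choose x ξ η hx hξ hη hin hval using hyT
  rw [Metric.mem_closure_iff]
  intro ε hε
  set δ : ℝ := ε / (‖a‖ * (‖b‖ + 1) + 1) with hδ
  have hδp : 0 < δ := by positivity
  obtain ⟨v, hv, hvk⟩ := transitivity (ρ := σ) (fun k l hkl S hS => irr_disj (hdis k l hkl) S hS)
    x (fun k => (σ k).π b (x k)) ξ η (fun k => by rw [hx, hξ]) (fun k => (hη k).symm) (fun k => (hin k).symm) δ hδp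
  let g : A →ₗ[ℂ] ℂ :=
    { toFun := fun c => ∑ k, (t k : ℂ) * ⟪x k, (σ k).π c (x k)⟫_ℂ
      map_add' := fun c d => by simp [inner_add_right, mul_add, Finset.sum_add_distrib]
      map_smul' := fun r c => by
        simp only [map_smul, ContinuousLinearMap.smul_apply, inner_smul_right, RingHom.id_apply, smul_eq_mul, Finset.mul_sum]
        exact Finset.sum_congr rfl fun k _ => by ring }
  have hg : ∀ c, g c = ∑ k, (t k : ℂ) * ⟪x k, (σ k).π c (x k)⟫_ℂ := fun c => rfl
  have hgn : ∀ c, ‖g c‖ ≤ 1 * ‖c‖ := by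
    intro c
    rw [hg, ← ht1, Finset.sum_mul]
    refine (norm_sum_le _ _).trans (Finset.sum_le_sum fun k _ => ?_)
    rw [norm_mul, Complex.norm_real, Real.norm_of_nonneg (ht0 k)]
    refine mul_le_mul_of_nonneg_left ?_ (ht0 k)
    refine (norm_inner_le_norm _ _).trans ?_
    have := pi_norm_le (σ k).π c (x k)
    rw [hx, mul_one] at this
    rwa [hx, one_mul]
  have hg1 : g 1 = 1 := by
    rw [hg]
    simp only [map_one, ContinuousLinearMap.one_apply, inner_self_eq_norm_sq_to_K, hx]
    simp [← Complex.ofReal_sum, ht1]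
  refine ⟨g (star v * a * star (star v) * b), Set.mem_iUnion.mpr ⟨⟨star v, Unitary.star_mem hv⟩, ?_⟩, ?_⟩
  · exact numRange_mk _ (g.mkContinuous 1 hgn) (LinearMap.mkContinuous_norm_le _ zero_le_one _) hg1
  · have hk : ∀ k, ‖y k - ⟪x k, (σ k).π (star v * a * star (star v) * b) (x k)⟫_ℂ‖ ≤ δ * (‖a‖ * (‖b‖ + 1)) := by
      intro k
      set p := (σ k).π with hp
      obtain ⟨q1, q2⟩ := hvk k
      have e1 : ⟪x k, p (star v * a * star (star v) * b) (x k)⟫_ℂ = ⟪p (star a) (p v (x k)), p v (p b (x k))⟫_ℂ := by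
        rw [pi_inner, pi_inner, star_star, star_star]; simp [map_mul]
      rw [e1, hval]
      have e2 : ⟪p (star a) (ξ k), η k⟫_ℂ - ⟪p (star a) (p v (x k)), p v (p b (x k))⟫_ℂ
          = - ⟪p (star a) (ξ k), p v (p b (x k)) - η k⟫_ℂ - ⟪p (star a) (p v (x k) - ξ k), p v (p b (x k))⟫_ℂ := by
        rw [map_sub, inner_sub_left, inner_sub_right]; ring
      rw [e2]
      refine (norm_sub_le _ _).trans ?_
      rw [norm_neg]
      have b1 := norm_inner_le_norm (𝕜 := ℂ) (p (star a) (ξ k)) (p v (p b (x k)) - η k)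
      have b2 := norm_inner_le_norm (𝕜 := ℂ) (p (star a) (p v (x k) - ξ k)) (p v (p b (x k)))
      have c1 := pi_norm_le p (star a) (ξ k)
      have c2 := pi_norm_le p (star a) (p v (x k) - ξ k)
      have c3 := pi_norm_le p b (x k)
      rw [norm_star] at c1 c2
      rw [hξ, mul_one] at c1
      rw [hx, mul_one] at c3
      rw [pi_unitary_norm p hv] at b2
      have d1 : ‖p (star a) (ξ k)‖ * ‖p v (p b (x k)) - η k‖ ≤ ‖a‖ * δ := by
        gcongr
      have d2 : ‖p (star a) (p v (x k) - ξ k)‖ * ‖p b (x k)‖ ≤ (‖a‖ * δ) * ‖b‖ := by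
        gcongr
        exact c2.trans (by gcongr)
      linarith
    rw [dist_eq_norm, hg, ← Finset.sum_sub_distrib]
    have hle : ‖∑ k, (t k • y k - (t k : ℂ) * ⟪x k, (σ k).π (star v * a * star (star v) * b) (x k)⟫_ℂ)‖ ≤ ∑ k, t k * (δ * (‖a‖ * (‖b‖ + 1))) := by
      refine (norm_sum_le _ _).trans (Finset.sum_le_sum fun k _ => ?_)
      rw [Complex.real_smul, ← mul_sub, norm_mul, Complex.norm_real, Real.norm_of_nonneg (ht0 k)]
      exact mul_le_mul_of_nonneg_left (hk k) (ht0 k)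
    refine hle.trans_lt ?_
    rw [← Finset.sum_mul, ht1, one_mul, hδ, div_mul_eq_mul_div, div_lt_iff₀ (by positivity)]
    nlinarith

theorem stmt8_cstar (a b : A) (M : A →L[ℂ] A) (hM : ∀ x, M x = a * x * b) :
    numRange (A →L[ℂ] A) M =
      closure (⋃ u : unitary A, numRange A ((u : A) * a * star (u : A) * b)) :=
  Set.Subset.antisymm
    ((sub_incl a b M hM).trans (closure_minimal (hull_sub a b) isClosed_closure))
    (sup_incl a b M hM)
end asm2


end Part9

theorem stmt8 (A : Type*) [NormedRing A] [StarRing A] [CStarRing A] [CompleteSpace A]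
    [NormedAlgebra ℂ A] [StarModule ℂ A] [NormOneClass A]
    (a b : A) (M : A →L[ℂ] A) (hM : ∀ x, M x = a * x * b) :
    numRange (A →L[ℂ] A) M =
      closure (⋃ u : unitary A, numRange A ((u : A) * a * star (u : A) * b)) := by
  letI : CStarAlgebra A := {}
  haveI : Nontrivial A := NormOneClass.nontrivial
  exact stmt8_cstar a b M hM
end

section
/- Let H be a complex Hilbert space and T ∈ B(H). Then the numerical range of the inner derivation δ_{π(T)} on the Calkin algebra equals the closure of the union over unitaries U of the essential numerical ranges V_e(U*TU − T). -/
open Filter Topology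

theorem mem_numRange_iff {A : Type*} [NormedRing A] [NormedAlgebra ℂ A] [NormOneClass A]
    (a : A) (z : ℂ) : z ∈ numRange A a ↔ ∀ c : ℂ, ‖z - c‖ ≤ ‖a - c • (1 : A)‖ := by
  constructor
  · rintro ⟨f, hf, h1, rfl⟩ c
    have := f.le_opNorm (a - c • (1 : A))
    simpa [hf, h1] using this
  · intro h
    have key : ∀ p q : ℂ, ‖p + q * z‖ ≤ ‖p • (1 : A) + q • a‖ := by
      intro p q
      by_cases hq : q = 0
      · simp [hq, norm_smul]
      · have h2 := h (-p / q)
        have e1 : p + q * z = q * (z - -p / q) := by field_simp; ring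
        have e2 : p • (1 : A) + q • a = q • (a - (-p / q) • (1 : A)) := by
          rw [smul_sub, smul_smul, mul_div_cancel₀ _ hq, neg_smul]; abel
        rw [e1, e2, norm_smul, norm_mul]
        gcongr
    let L : ℂ × ℂ →ₗ[ℂ] A :=
      (LinearMap.toSpanSingleton ℂ A 1).coprod (LinearMap.toSpanSingleton ℂ A a)
    let ev : ℂ × ℂ →ₗ[ℂ] ℂ :=
      (LinearMap.toSpanSingleton ℂ ℂ 1).coprod (LinearMap.toSpanSingleton ℂ ℂ z)
    have hLev : ∀ v, ‖ev v‖ ≤ ‖L v‖ := by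
      intro v
      simpa [L, ev] using key v.1 v.2
    have hmem : ev ∈ LinearMap.range L.dualMap := by
      rw [LinearMap.range_dualMap_eq_dualAnnihilator_ker, Submodule.mem_dualAnnihilator]
      intro w hw
      have h3 := hLev w
      rw [LinearMap.mem_ker.mp hw, norm_zero] at h3
      exact norm_le_zero_iff.mp h3
    obtain ⟨φ, hφ⟩ := hmem
    have hφ' : ∀ v, φ (L v) = ev v := fun v => by rw [← hφ]; rfl
    let g : (LinearMap.range L) →L[ℂ] ℂ :=
      (φ.comp (LinearMap.range L).subtype).mkContinuous 1 (by
        rintro ⟨_, v, rfl⟩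
        simpa [hφ'] using hLev v)
    have hg : ‖g‖ ≤ 1 := LinearMap.mkContinuous_norm_le _ zero_le_one _
    obtain ⟨F, hF, hFn⟩ := exists_extension_norm_eq (𝕜 := ℂ) (LinearMap.range L) g
    have hFL : ∀ v, F (L v) = ev v := by
      intro v
      have := hF ⟨L v, v, rfl⟩
      rw [← hφ' v]
      simpa [g] using this
    have hF1 : F 1 = 1 := by simpa [L, ev] using hFL (1, 0)
    have hFa : F a = z := by simpa [L, ev] using hFL (0, 1)
    refine ⟨F, le_antisymm (hFn ▸ hg) ?_, hF1, hFa⟩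
    have := F.le_opNorm 1
    simpa [hF1] using this

theorem isClosed_numRange {A : Type*} [NormedRing A] [NormedAlgebra ℂ A] [NormOneClass A]
    (a : A) : IsClosed (numRange A a) := by
  have : numRange A a = ⋂ c : ℂ, {z | ‖z - c‖ ≤ ‖a - c • (1 : A)‖} := by
    ext z; simp [mem_numRange_iff]
  rw [this]
  exact isClosed_iInter fun c => isClosed_le (by fun_prop) (by fun_prop)

section
variable {H : Type*} [NormedAddCommGroup H] [InnerProductSpace ℂ H]

def nrS (T : H →L[ℂ] H) (s : Finset H) : Set ℂ :=
  {z | ∃ x : H, ‖x‖ = 1 ∧ (∀ y ∈ s, inner ℂ y x = 0) ∧ inner ℂ x (T x) = z}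

theorem compact_inner_tendsto {v : ℕ → H} (hv : Orthonormal ℂ v) (K : H →L[ℂ] H)
    (hK : IsCompactOperator K) : Tendsto (fun n => inner ℂ (v n) (K (v n))) atTop (𝓝 0) := by
  obtain ⟨S, hS, hKS⟩ := hK.image_closedBall_subset_compact (𝕜₁ := ℂ) (f := (K : H →ₗ[ℂ] H)) 1
  rw [Metric.tendsto_atTop']
  intro ε hε
  obtain ⟨t, -, htf, ht⟩ := hS.finite_cover_balls (half_pos hε)
  have hw : ∀ y : H, ∀ᶠ n in atTop, ‖inner ℂ (v n) y‖ < ε / 2 := by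
    intro y
    have h1 := (hv.inner_products_summable (x := y)).tendsto_atTop_zero
    have h2 : ∀ᶠ n in atTop, ‖inner ℂ (v n) y‖ ^ 2 < (ε / 2) ^ 2 :=
      h1.eventually_lt_const (by positivity)
    filter_upwards [h2] with n hn
    exact lt_of_pow_lt_pow_left₀ 2 (by positivity) hn
  have hall : ∀ᶠ n in atTop, ∀ y ∈ t, ‖inner ℂ (v n) y‖ < ε / 2 :=
    (htf.eventually_all).mpr fun y _ => hw y
  obtain ⟨N, hN⟩ := eventually_atTop.mp hall
  refine ⟨N, fun n hn => ?_⟩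
  have hmem : K (v n) ∈ S := hKS ⟨v n, by simp [hv.1 n], rfl⟩
  obtain ⟨y, hy, hyb⟩ := Set.mem_iUnion₂.mp (ht hmem)
  rw [dist_zero_right]
  have e : inner ℂ (v n) (K (v n)) = inner ℂ (v n) y + inner ℂ (v n) (K (v n) - y) := by
    rw [← inner_add_right]; simp
  rw [e]
  have h4 : ‖inner ℂ (v n) (K (v n) - y)‖ < ε / 2 := by
    refine lt_of_le_of_lt (norm_inner_le_norm _ _) ?_
    rw [hv.1 n, one_mul, ← dist_eq_norm]; exact hyb
  linarith [norm_add_le (inner ℂ (v n) y) (inner ℂ (v n) (K (v n) - y)), hN n hn.le y hy]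

variable [CompleteSpace H]

theorem convex_essRange (T : H →L[ℂ] H) : Convex ℝ (⋂ s : Finset H, closure (nrS T s)) := by
  classical
  intro z1 h1 z2 h2 a b ha hb hab
  rw [Set.mem_iInter] at h1 h2 ⊢
  intro s
  rw [Metric.mem_closure_iff]
  intro ε hε
  obtain ⟨_, ⟨x1, hx1, hs1, rfl⟩, hd1⟩ := Metric.mem_closure_iff.mp (h1 s) ε hε
  obtain ⟨_, ⟨x2, hx2, hs2, rfl⟩, hd2⟩ := Metric.mem_closure_iff.mp
    (h2 (s ∪ {x1, T x1, ContinuousLinearMap.adjoint T x1})) ε hε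
  have o1 : inner ℂ x1 x2 = 0 := hs2 _ (by simp)
  have o1' : inner ℂ x2 x1 = 0 := inner_eq_zero_symm.mp o1
  have o2 : inner ℂ x2 (T x1) = 0 := inner_eq_zero_symm.mp (hs2 _ (by simp))
  have o3 : inner ℂ x1 (T x2) = 0 := by
    rw [← ContinuousLinearMap.adjoint_inner_left]; exact hs2 _ (by simp)
  have ra : ((√a : ℝ) : ℂ) * (√a : ℝ) = a := by
    rw [← Complex.ofReal_mul, Real.mul_self_sqrt ha]
  have rb : ((√b : ℝ) : ℂ) * (√b : ℝ) = b := by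
    rw [← Complex.ofReal_mul, Real.mul_self_sqrt hb]
  refine ⟨_, ⟨((√a : ℝ) : ℂ) • x1 + ((√b : ℝ) : ℂ) • x2, ?_, ?_, rfl⟩, ?_⟩
  · have h5 : ‖((√a : ℝ) : ℂ) • x1 + ((√b : ℝ) : ℂ) • x2‖ ^ 2 = 1 := by
      rw [norm_add_sq (𝕜 := ℂ), inner_smul_left, inner_smul_right, o1, norm_smul, norm_smul, hx1,
        hx2, Complex.norm_real, Complex.norm_real, Real.norm_of_nonneg (Real.sqrt_nonneg _),
        Real.norm_of_nonneg (Real.sqrt_nonneg _), mul_one, mul_one, Real.sq_sqrt ha,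
        Real.sq_sqrt hb]
      simpa using hab
    exact (pow_eq_one_iff_of_nonneg (norm_nonneg _) two_ne_zero).mp h5
  · intro y hy
    simp [inner_add_right, inner_smul_right, hs1 y hy, hs2 y (by simp [hy])]
  · have e : inner ℂ (((√a : ℝ) : ℂ) • x1 + ((√b : ℝ) : ℂ) • x2)
        (T (((√a : ℝ) : ℂ) • x1 + ((√b : ℝ) : ℂ) • x2))
        = a * inner ℂ x1 (T x1) + b * inner ℂ x2 (T x2) := by
      simp only [map_add, map_smul, inner_add_left, inner_add_right, inner_smul_left,
        inner_smul_right, o2, o3, Complex.conj_ofReal]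
      linear_combination ra * inner ℂ x1 (T x1) + rb * inner ℂ x2 (T x2)
    rw [e, dist_eq_norm]
    rw [dist_eq_norm] at hd1 hd2
    have e2 : a • z1 + b • z2 - (a * inner ℂ x1 (T x1) + b * inner ℂ x2 (T x2))
      = a • (z1 - inner ℂ x1 (T x1)) + b • (z2 - inner ℂ x2 (T x2)) := by
      simp only [Complex.real_smul]; ring
    rw [e2]
    have h6 := norm_add_le (a • (z1 - inner ℂ x1 (T x1))) (b • (z2 - inner ℂ x2 (T x2)))
    rw [norm_smul, norm_smul, Real.norm_of_nonneg ha, Real.norm_of_nonneg hb] at h6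
    rcases ha.eq_or_lt with h0 | h0
    · subst h0
      have : b = 1 := by linarith
      subst this
      linarith
    · nlinarith

theorem isCompact_nrS (T : H →L[ℂ] H) (s : Finset H) : IsCompact (closure (nrS T s)) := by
  refine Metric.isCompact_of_isClosed_isBounded isClosed_closure (Bornology.IsBounded.closure ?_)
  refine (Metric.isBounded_closedBall (x := (0 : ℂ)) (r := ‖T‖)).subset ?_
  rintro _ ⟨x, hx, -, rfl⟩
  rw [mem_closedBall_zero_iff]
  have h1 := norm_inner_le_norm (𝕜 := ℂ) x (T x)
  have h2 := T.le_opNorm x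
  rw [hx] at h1 h2
  linarith

theorem isCompactOperator_starProjection (T : H →L[ℂ] H) (M : Submodule ℂ H)
    [FiniteDimensional ℂ M] : IsCompactOperator (T * M.starProjection : H →L[ℂ] H) := by
  have h1 : IsCompactOperator (M.orthogonalProjectionOnto : H →L[ℂ] M) :=
    isCompactOperator_of_locallyCompactSpace_dom _
  exact h1.clm_comp (T ∘L M.subtypeL)

/-- Small norm of the compression. -/
theorem compression_norm (B : H →L[ℂ] H) (M : Submodule ℂ H) [FiniteDimensional ℂ M]
    (c : ℝ) (hc : 0 < c) (hB : ∀ x ∈ Mᗮ, ‖x‖ = 1 → (inner ℂ x (B x)).re ≤ -c) :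
    ∃ s : ℝ, ‖(1 + (s : ℂ) • B) - (1 + (s : ℂ) • B) * M.starProjection‖ < 1 := by
  set s : ℝ := c / (‖B‖ ^ 2 + c ^ 2 + 1) with hs
  have hs0 : 0 < s := by positivity
  have hsb : s * ‖B‖ ^ 2 ≤ c := by
    rw [hs, div_mul_eq_mul_div, div_le_iff₀ (by positivity)]
    nlinarith [sq_nonneg c, sq_nonneg ‖B‖]
  have hsc : s * c < 1 := by
    rw [hs, div_mul_eq_mul_div, div_lt_one (by positivity)]
    nlinarith [sq_nonneg ‖B‖]
  have hB' : ∀ y ∈ Mᗮ, (inner ℂ y (B y)).re ≤ -c * ‖y‖ ^ 2 := by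
    intro y hy
    by_cases h0 : y = 0
    · simp [h0]
    have hn : 0 < ‖y‖ := norm_pos_iff.mpr h0
    have h1 := hB (((‖y‖⁻¹ : ℝ) : ℂ) • y) (Mᗮ.smul_mem _ hy) (by
      rw [norm_smul, Complex.norm_real, norm_inv, norm_norm, inv_mul_cancel₀ hn.ne'])
    rw [map_smul, inner_smul_left, inner_smul_right, Complex.conj_ofReal, Complex.re_ofReal_mul,
      Complex.re_ofReal_mul] at h1
    have e : (inner ℂ y (B y)).re = (‖y‖⁻¹ * (‖y‖⁻¹ * (inner ℂ y (B y)).re)) * ‖y‖ ^ 2 := by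
      field_simp
    rw [e]
    gcongr
  refine ⟨s, lt_of_le_of_lt (ContinuousLinearMap.opNorm_le_bound _ (Real.sqrt_nonneg (1 - s * c))
    fun x => ?_) (by rw [Real.sqrt_lt' one_pos]; nlinarith)⟩
  set y := x - M.starProjection x with hy
  have hyM : y ∈ Mᗮ := M.sub_starProjection_mem_orthogonal x
  have hyx : ‖y‖ ≤ ‖x‖ := by
    have : y = Mᗮ.starProjection x := by
      rw [Submodule.starProjection_orthogonal]; simp [hy]
    rw [this]; exact Submodule.norm_starProjection_apply_le _ _
  have e1 : ((1 + (s : ℂ) • B) - (1 + (s : ℂ) • B) * M.starProjection) x = y + (s : ℂ) • B y := by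
    simp [hy, smul_sub]; abel
  rw [e1]
  refine le_trans ?_ (mul_le_mul_of_nonneg_left hyx (Real.sqrt_nonneg _))
  refine (pow_le_pow_iff_left₀ (norm_nonneg _) (by positivity) two_ne_zero).mp ?_
  rw [mul_pow, Real.sq_sqrt (by linarith), norm_add_sq (𝕜 := ℂ), inner_smul_right, norm_smul,
    Complex.norm_real, Real.norm_of_nonneg hs0.le]
  have h3 := hB' y hyM
  have h4 : (s * ‖B y‖) ^ 2 ≤ s * c * ‖y‖ ^ 2 := by
    have : ‖B y‖ ^ 2 ≤ ‖B‖ ^ 2 * ‖y‖ ^ 2 := by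
      rw [← mul_pow]; gcongr; exact B.le_opNorm y
    calc (s * ‖B y‖) ^ 2 = s * (s * ‖B y‖ ^ 2) := by ring
      _ ≤ s * (s * (‖B‖ ^ 2 * ‖y‖ ^ 2)) := by gcongr
      _ = s * (s * ‖B‖ ^ 2) * ‖y‖ ^ 2 := by ring
      _ ≤ _ := by gcongr
  have h5 : RCLike.re ((s : ℂ) * inner ℂ y (B y)) = s * (inner ℂ y (B y)).re :=
    Complex.re_ofReal_mul _ _
  rw [h5]
  nlinarith


theorem mem_essRange (C : Type*) [NormedRing C] [NormedAlgebra ℂ C] [NormOneClass C]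
    (π : (H →L[ℂ] H) →ₐ[ℂ] C)
    (hπ_ker : ∀ S : H →L[ℂ] H, π S = 0 ↔ IsCompactOperator S)
    (hπ_le : ∀ S : H →L[ℂ] H, ‖π S‖ ≤ ‖S‖) (T : H →L[ℂ] H) (z : ℂ)
    (hz : z ∈ numRange C (π T)) : z ∈ ⋂ s : Finset H, closure (nrS T s) := by
  classical
  by_contra hnot
  obtain ⟨l, u, hl, hlz⟩ := RCLike.geometric_hahn_banach_closed_point (𝕜 := ℂ) (convex_essRange T)
    (isClosed_iInter fun s => isClosed_closure) hnot
  have hopen : IsOpen {w : ℂ | RCLike.re (l w) < u} :=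
    isOpen_lt (RCLike.continuous_re.comp l.continuous) continuous_const
  obtain ⟨s, hs⟩ := exists_subset_nhds_of_isCompact (V := fun s : Finset H => closure (nrS T s))
    (U := {w : ℂ | RCLike.re (l w) < u})
    (by
      intro s t
      refine ⟨s ∪ t, closure_mono ?_, closure_mono ?_⟩
      · rintro _ ⟨x, h1, h2, rfl⟩
        exact ⟨x, h1, fun y hy => h2 y (Finset.mem_union_left _ hy), rfl⟩
      · rintro _ ⟨x, h1, h2, rfl⟩
        exact ⟨x, h1, fun y hy => h2 y (Finset.mem_union_right _ hy), rfl⟩)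
    (isCompact_nrS T) (fun w hw => hopen.mem_nhds (hl w hw))
  set M : Submodule ℂ H := Submodule.span ℂ (s : Set H) with hM
  haveI : FiniteDimensional ℂ M := FiniteDimensional.span_finset ℂ s
  have hlw : ∀ w : ℂ, l w = l 1 * w := by
    intro w
    have := l.map_smul w 1
    rw [smul_eq_mul, mul_one, smul_eq_mul] at this
    rw [this, mul_comm]
  set B : H →L[ℂ] H := l 1 • (T - z • (1 : H →L[ℂ] H)) with hBdef
  obtain ⟨r, hr⟩ := compression_norm B M (RCLike.re (l z) - u) (by linarith) (by
    intro x hx hx1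
    have h1 : RCLike.re (l (inner ℂ x (T x))) < u := by
      refine hs (subset_closure ⟨x, hx1, fun y hy => ?_, rfl⟩)
      exact hx y (Submodule.subset_span hy)
    have h2 : inner ℂ x (B x) = l (inner ℂ x (T x)) - l z := by
      rw [hlw (inner ℂ x (T x)), hlw z]
      simp [hBdef, inner_smul_right, inner_sub_right, inner_self_eq_norm_sq_to_K, hx1]
      ring
    rw [h2, Complex.sub_re]
    change _ ≤ -((l z).re - u)
    change (l (inner ℂ x (T x))).re < u at h1
    linarith)
  obtain ⟨f, hf, hf1, hfz⟩ := hz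
  have h0 : π ((1 + (r : ℂ) • B) * M.starProjection) = 0 :=
    (hπ_ker _).mpr (isCompactOperator_starProjection _ M)
  have h1 := hπ_le ((1 + (r : ℂ) • B) - (1 + (r : ℂ) • B) * M.starProjection)
  rw [map_sub, h0, sub_zero] at h1
  have h2 := f.le_opNorm (π (1 + (r : ℂ) • B))
  have h3 : f (π (1 + (r : ℂ) • B)) = 1 := by
    rw [hBdef, map_add π, map_smul π, map_smul π, map_sub π, map_smul π, map_one π, map_add f,
      map_smul f, map_smul f, map_sub f, map_smul f, hf1, hfz]
    simp
  rw [h3, hf, one_mul, norm_one] at h2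
  linarith

theorem exists_seq (T : H →L[ℂ] H) (p q : ℂ) (hp : p ∈ ⋂ s : Finset H, closure (nrS T s))
    (hq : q ∈ ⋂ s : Finset H, closure (nrS T s)) :
    ∃ e g : ℕ → H, Orthonormal ℂ e ∧ Orthonormal ℂ g ∧ (∀ m n, inner ℂ (e m) (g n) = 0) ∧
      Tendsto (fun n => inner ℂ (e n) (T (e n))) atTop (𝓝 p) ∧
      Tendsto (fun n => inner ℂ (g n) (T (g n))) atTop (𝓝 q) := by
  classical
  rw [Set.mem_iInter] at hp hq
  obtain ⟨f, hf, hr⟩ := exists_seq_of_forall_finset_exists (α := ℕ × H × H)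
    (fun a => ‖a.2.1‖ = 1 ∧ ‖a.2.2‖ = 1 ∧ inner ℂ a.2.1 a.2.2 = 0 ∧
      dist (inner ℂ a.2.1 (T a.2.1)) p < 1 / ((a.1 : ℝ) + 1) ∧
      dist (inner ℂ a.2.2 (T a.2.2)) q < 1 / ((a.1 : ℝ) + 1))
    (fun a b => a.1 < b.1 ∧ inner ℂ a.2.1 b.2.1 = 0 ∧ inner ℂ a.2.1 b.2.2 = 0 ∧
      inner ℂ a.2.2 b.2.1 = 0 ∧ inner ℂ a.2.2 b.2.2 = 0) (by
      intro s _
      set k : ℕ := s.sup (fun a => a.1) + 1 with hk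
      set t : Finset H := s.image (fun a => a.2.1) ∪ s.image (fun a => a.2.2) with ht
      have hpos : (0 : ℝ) < 1 / ((k : ℝ) + 1) := by positivity
      obtain ⟨_, ⟨x1, hx1, hs1, rfl⟩, hd1⟩ := Metric.mem_closure_iff.mp (hp t) _ hpos
      obtain ⟨_, ⟨x2, hx2, hs2, rfl⟩, hd2⟩ := Metric.mem_closure_iff.mp (hq (t ∪ {x1})) _ hpos
      refine ⟨(k, x1, x2), ⟨hx1, hx2, hs2 _ (by simp), by rwa [dist_comm], by rwa [dist_comm]⟩, ?_⟩
      intro a ha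
      have ha1 : a.2.1 ∈ t := Finset.mem_union_left _ (Finset.mem_image_of_mem _ ha)
      have ha2 : a.2.2 ∈ t := Finset.mem_union_right _ (Finset.mem_image_of_mem _ ha)
      exact ⟨Nat.lt_succ_of_le (Finset.le_sup (f := fun a : ℕ × H × H => a.1) ha), hs1 _ ha1,
        hs2 _ (Finset.mem_union_left _ ha1), hs1 _ ha2, hs2 _ (Finset.mem_union_left _ ha2)⟩)
  have hmono : StrictMono fun n => (f n).1 := fun m n h => (hr m n h).1
  have hlim : Tendsto (fun n => 1 / (((f n).1 : ℝ) + 1)) atTop (𝓝 0) :=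
    tendsto_one_div_add_atTop_nhds_zero_nat.comp hmono.tendsto_atTop
  refine ⟨fun n => (f n).2.1, fun n => (f n).2.2, ⟨fun n => (hf n).1, fun m n hmn => ?_⟩,
    ⟨fun n => (hf n).2.1, fun m n hmn => ?_⟩, fun m n => ?_, ?_, ?_⟩
  · rcases lt_or_gt_of_ne hmn with h | h
    · exact (hr m n h).2.1
    · exact inner_eq_zero_symm.mp (hr n m h).2.1
  · rcases lt_or_gt_of_ne hmn with h | h
    · exact (hr m n h).2.2.2.2
    · exact inner_eq_zero_symm.mp (hr n m h).2.2.2.2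
  · rcases lt_trichotomy m n with h | h | h
    · exact (hr m n h).2.2.1
    · subst h; exact (hf m).2.2.1
    · exact inner_eq_zero_symm.mp (hr n m h).2.2.2.1
  · rw [tendsto_iff_dist_tendsto_zero]
    exact squeeze_zero (fun _ => dist_nonneg) (fun n => (hf n).2.2.2.1.le) hlim
  · rw [tendsto_iff_dist_tendsto_zero]
    exact squeeze_zero (fun _ => dist_nonneg) (fun n => (hf n).2.2.2.2.le) hlim

theorem exists_swap_unitary (e g : ℕ → H) (he : Orthonormal ℂ e) (hg : Orthonormal ℂ g)
    (heg : ∀ m n, inner ℂ (e m) (g n) = 0) :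
    ∃ U : unitary (H →L[ℂ] H), ∀ n, (U : H →L[ℂ] H) (g n) = e n := by
  classical
  set D : Submodule ℂ H := Submodule.span ℂ (Set.range fun n => g n - e n) with hD
  refine ⟨Unitary.linearIsometryEquiv.symm (Dᗮ.reflection), fun n => ?_⟩
  have hge : ∀ m n, inner ℂ (g m) (e n) = 0 := fun m n => inner_eq_zero_symm.mp (heg n m)
  have h1 : Dᗮ.reflection (g n - e n) = -(g n - e n) :=
    Submodule.reflection_mem_subspace_orthogonalComplement_eq_neg
      (D.le_orthogonal_orthogonal (Submodule.subset_span ⟨n, rfl⟩))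
  have h2 : Dᗮ.reflection (g n + e n) = g n + e n := by
    apply Submodule.reflection_mem_subspace_eq_self
    have : D ≤ (Submodule.span ℂ {g n + e n})ᗮ := by
      rw [hD, Submodule.span_le]
      rintro _ ⟨m, rfl⟩
      rw [SetLike.mem_coe, Submodule.mem_orthogonal_singleton_iff_inner_right]
      simp only [inner_add_left, inner_sub_right, heg, hge, orthonormal_iff_ite.mp he,
        orthonormal_iff_ite.mp hg]
      simp
    rw [Submodule.mem_orthogonal]
    intro y hy
    exact (Submodule.mem_orthogonal_singleton_iff_inner_left.mp (this hy))
  have h3 : Dᗮ.reflection (g n) = e n := by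
    have e1 : (2 : ℂ) • g n = (g n - e n) + (g n + e n) := by rw [two_smul]; abel
    have h4 : (2 : ℂ) • Dᗮ.reflection (g n) = (2 : ℂ) • e n := by
      rw [← map_smul, e1, map_add, h1, h2, two_smul]; abel
    exact smul_right_injective H (two_ne_zero (α := ℂ)) h4
  rw [Unitary.coe_symm_linearIsometryEquiv_apply]
  exact h3

end

theorem stmt11 (H : Type*) [NormedAddCommGroup H] [InnerProductSpace ℂ H] [CompleteSpace H]
    -- the Calkin algebra `C = B(H)/K(H)`, presented abstractly
    (C : Type*) [NormedRing C] [NormedAlgebra ℂ C] [CompleteSpace C] [NormOneClass C]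
    (π : (H →L[ℂ] H) →ₐ[ℂ] C) (hπ_surj : Function.Surjective π)
    (hπ_ker : ∀ S : H →L[ℂ] H, π S = 0 ↔ IsCompactOperator S)
    (hπ_norm : ∀ S : H →L[ℂ] H,
      ‖π S‖ = ⨅ K : {K : H →L[ℂ] H // IsCompactOperator K}, ‖S + (K : H →L[ℂ] H)‖)
    (T : H →L[ℂ] H)
    (δ : C →L[ℂ] C) (hδ : ∀ x, δ x = π T * x - x * π T) :
    numRange (C →L[ℂ] C) δ =
      closure (⋃ U : unitary (H →L[ℂ] H),
        numRange C (π (star (U : H →L[ℂ] H) * T * (U : H →L[ℂ] H) - T))) := by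
  haveI : Nontrivial C := NormOneClass.nontrivial
  haveI : Nontrivial (H →L[ℂ] H) := π.toRingHom.domain_nontrivial
  have hπ_le : ∀ S : H →L[ℂ] H, ‖π S‖ ≤ ‖S‖ := by
    intro S
    rw [hπ_norm]
    refine (ciInf_le ⟨0, ?_⟩ ⟨0, isCompactOperator_zero⟩).trans (by simp)
    rintro _ ⟨K, rfl⟩
    exact norm_nonneg _
  apply Set.Subset.antisymm
  · rintro _ ⟨F, hF, hF1, rfl⟩
    have hp : F (ContinuousLinearMap.mul ℂ C (π T)) ∈ numRange C (π T) := by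
      rw [mem_numRange_iff]
      intro c
      have h1 : F (ContinuousLinearMap.mul ℂ C (π T)) - c =
          F (ContinuousLinearMap.mul ℂ C (π T - c • (1 : C))) := by
        have : ContinuousLinearMap.mul ℂ C (1 : C) = 1 := by ext x; simp
        rw [map_sub, map_smul, this, map_sub, map_smul, hF1]; simp
      rw [h1]
      refine (F.le_opNorm _).trans ?_
      rw [hF, one_mul]
      exact ContinuousLinearMap.opNorm_mul_apply_le ℂ C _
    have hq : F ((ContinuousLinearMap.mul ℂ C).flip (π T)) ∈ numRange C (π T) := by
      rw [mem_numRange_iff]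
      intro c
      have h1 : F ((ContinuousLinearMap.mul ℂ C).flip (π T)) - c =
          F ((ContinuousLinearMap.mul ℂ C).flip (π T - c • (1 : C))) := by
        have : (ContinuousLinearMap.mul ℂ C).flip (1 : C) = 1 := by ext x; simp
        rw [map_sub, map_smul, this, map_sub, map_smul, hF1]; simp
      rw [h1]
      refine (F.le_opNorm _).trans ?_
      rw [hF, one_mul]
      refine ContinuousLinearMap.opNorm_le_bound _ (norm_nonneg _) fun x => ?_
      rw [ContinuousLinearMap.flip_apply, ContinuousLinearMap.mul_apply', mul_comm ‖_‖ ‖x‖]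
      exact norm_mul_le _ _
    have hδ' : δ = ContinuousLinearMap.mul ℂ C (π T) - (ContinuousLinearMap.mul ℂ C).flip (π T) := by
      ext x; simp [hδ]
    rw [hδ', map_sub]
    set p := F (ContinuousLinearMap.mul ℂ C (π T))
    set q := F ((ContinuousLinearMap.mul ℂ C).flip (π T))
    obtain ⟨e, g, he, hg, heg, hep, hgq⟩ := exists_seq T p q
      (mem_essRange C π hπ_ker hπ_le T p hp) (mem_essRange C π hπ_ker hπ_le T q hq)
    obtain ⟨U, hU⟩ := exists_swap_unitary e g he hg heg
    refine subset_closure (Set.mem_iUnion.mpr ⟨U, ?_⟩)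
    rw [mem_numRange_iff]
    intro c
    set S : H →L[ℂ] H := star (U : H →L[ℂ] H) * T * (U : H →L[ℂ] H) - T with hS
    have h1 : π S - c • (1 : C) = π (S - c • (1 : H →L[ℂ] H)) := by simp
    rw [h1, hπ_norm]
    haveI : Nonempty {K : H →L[ℂ] H // IsCompactOperator K} := ⟨⟨0, isCompactOperator_zero⟩⟩
    refine le_ciInf fun K => ?_
    have hSg : ∀ n, inner ℂ (g n) ((S - c • (1 : H →L[ℂ] H) + (K : H →L[ℂ] H)) (g n)) =
        inner ℂ (e n) (T (e n)) - inner ℂ (g n) (T (g n)) - c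
          + inner ℂ (g n) ((K : H →L[ℂ] H) (g n)) := by
      intro n
      have h2 : inner ℂ (g n) ((star (U : H →L[ℂ] H)) (T (e n))) = inner ℂ (e n) (T (e n)) := by
        rw [ContinuousLinearMap.star_eq_adjoint, ContinuousLinearMap.adjoint_inner_right, hU]
      simp [hS, inner_add_right, inner_sub_right, inner_smul_right, hU, h2,
        inner_self_eq_norm_sq_to_K, hg.1 n]
    have hlim : Tendsto (fun n => ‖inner ℂ (g n)
        ((S - c • (1 : H →L[ℂ] H) + (K : H →L[ℂ] H)) (g n))‖) atTop (𝓝 ‖p - q - c + 0‖) := by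
      simp only [hSg]
      exact (((hep.sub hgq).sub_const c).add (compact_inner_tendsto hg K K.2)).norm
    rw [add_zero] at hlim
    refine le_of_tendsto' hlim fun n => ?_
    have h3 := norm_inner_le_norm (𝕜 := ℂ) (g n)
      ((S - c • (1 : H →L[ℂ] H) + (K : H →L[ℂ] H)) (g n))
    have h4 := (S - c • (1 : H →L[ℂ] H) + (K : H →L[ℂ] H)).le_opNorm (g n)
    rw [hg.1 n, one_mul] at h3
    rw [hg.1 n, mul_one] at h4
    exact h3.trans h4
  · refine closure_minimal (Set.iUnion_subset fun U => ?_) (isClosed_numRange δ)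
    rintro _ ⟨f, hf, hf1, rfl⟩
    rw [mem_numRange_iff]
    intro c
    have hU1 : ‖π (U : H →L[ℂ] H)‖ ≤ 1 := (hπ_le _).trans ((CStarRing.norm_of_mem_unitary U.2).le)
    have hU2 : ‖π (star (U : H →L[ℂ] H))‖ ≤ 1 := (hπ_le _).trans (by
      rw [norm_star]; exact (CStarRing.norm_of_mem_unitary U.2).le)
    have hUU : π (star (U : H →L[ℂ] H)) * π (U : H →L[ℂ] H) = 1 := by
      rw [← map_mul, Unitary.coe_star_mul_self, map_one]
    have h1 : f (π (star (U : H →L[ℂ] H) * T * (U : H →L[ℂ] H) - T)) - c =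
        f (π (star (U : H →L[ℂ] H)) * (δ - c • (1 : C →L[ℂ] C)) (π (U : H →L[ℂ] H))) := by
      have : π (star (U : H →L[ℂ] H)) * (δ - c • (1 : C →L[ℂ] C)) (π (U : H →L[ℂ] H)) =
          π (star (U : H →L[ℂ] H) * T * (U : H →L[ℂ] H) - T) - c • (1 : C) := by
        simp only [sub_apply, smul_apply,
          one_apply_eq_self, hδ, mul_sub, map_sub, map_mul, mul_smul_comm, hUU,
          ← mul_assoc, one_mul]
      rw [this, map_sub f, map_smul f, hf1]; simp
    rw [h1]
    refine (f.le_opNorm _).trans ?_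
    rw [hf, one_mul]
    refine (norm_mul_le _ _).trans ?_
    have h2 := (δ - c • (1 : C →L[ℂ] C)).le_opNorm (π (U : H →L[ℂ] H))
    calc _ ≤ 1 * (‖δ - c • (1 : C →L[ℂ] C)‖ * 1) := by
            refine mul_le_mul hU2 (h2.trans ?_) (norm_nonneg _) zero_le_one
            gcongr
      _ = _ := by ring
end
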